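/- arXiv:0807.1174 — 5 statements merged into one kernel-verified Lean document; each statement's English description precedes it below -/
import Mathlib

section
/- Let p be a prime, m ≥ 1, and let K = ℚ_p(ζ_{p^m}) be the p^m-th cyclotomic extension of ℚ_p. Then N_{K/ℚ_p}(U_{p^m, K}) ⊆ U_{m+1, ℚ_p}; that is, for every unit u ∈ O_K^× with v_K(1−u) ≥ p^m (where v_K is the surjective valuation of K), one has N_{K/ℚ_p}(u) ≡ 1 (mod p^{m+1}). -/
set_option synthInstance.maxHeartbeats 1000000
set_option maxHeartbeats 1000000
noncomputable section

namespace PadicStmt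

variable (p : ℕ) [Fact p.Prime]

/-- The `ℤ_[p]`-algebra structure on a `ℚ_[p]`-algebra. -/
noncomputable instance zpAlgebra (K : Type) [Field K] [Algebra ℚ_[p] K] :
    Algebra ℤ_[p] K :=
  ((algebraMap ℚ_[p] K).comp (algebraMap ℤ_[p] ℚ_[p])).toAlgebra

instance zpTower (K : Type) [Field K] [Algebra ℚ_[p] K] :
    IsScalarTower ℤ_[p] ℚ_[p] K :=
  IsScalarTower.of_algebraMap_eq fun _ => rfl

instance zpTower' (K L : Type) [Field K] [Field L] [Algebra ℚ_[p] K] [Algebra ℚ_[p] L]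
    [Algebra K L] [IsScalarTower ℚ_[p] K L] : IsScalarTower ℤ_[p] K L :=
  IsScalarTower.of_algebraMap_eq fun x => by
    rw [IsScalarTower.algebraMap_apply ℤ_[p] ℚ_[p] L, IsScalarTower.algebraMap_apply ℚ_[p] K L,
      IsScalarTower.algebraMap_apply ℤ_[p] ℚ_[p] K]

/-- The ring of integers of a `p`-adic field `K`, i.e. the integral closure of `ℤ_[p]` in `K`. -/
abbrev O (K : Type) [Field K] [Algebra ℚ_[p] K] := integralClosure ℤ_[p] K

/-- The natural map `O_K → O_L` for an extension `L/K` of `p`-adic fields. -/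
def intMap (K L : Type) [Field K] [Field L] [Algebra ℚ_[p] K] [Algebra ℚ_[p] L]
    [Algebra K L] [IsScalarTower ℚ_[p] K L] : O p K →+* O p L where
  toFun x := ⟨algebraMap K L x.1, IsIntegral.map (IsScalarTower.toAlgHom ℤ_[p] K L) x.2⟩
  map_one' := Subtype.ext (map_one _)
  map_mul' x y := Subtype.ext (map_mul _ _ _)
  map_zero' := Subtype.ext (map_zero _)
  map_add' x y := Subtype.ext (map_add _ _ _)

/-- The maximal ideal of the ring of integers of a `p`-adic field, described as the
Jacobson radical of `⊥`. -/
def maxIdeal (K : Type) [Field K] [Algebra ℚ_[p] K] : Ideal (O p K) :=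
  (⊥ : Ideal (O p K)).jacobson

/-- `v_K x ≥ n`:  `x` is integral and lies in the `n`-th power of the maximal ideal. -/
def ValGE (K : Type) [Field K] [Algebra ℚ_[p] K] (n : ℕ) (x : K) : Prop :=
  ∃ y : O p K, (y : K) = x ∧ y ∈ (maxIdeal p K) ^ n

/-- `x : K` is a unit of the ring of integers `O_K`. -/
def IsIntegralUnit (K : Type) [Field K] [Algebra ℚ_[p] K] (x : K) : Prop :=
  ∃ u : (O p K)ˣ, ((u : O p K) : K) = x

/-- `x ∈ U_{n,K}`, the `n`-th unit group: `x` is a unit of `O_K` and `v_K (1 - x) ≥ n`. -/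
def InU (K : Type) [Field K] [Algebra ℚ_[p] K] (n : ℕ) (x : K) : Prop :=
  IsIntegralUnit p K x ∧ ValGE p K n (1 - x)

/-- An extension `L/K` of `p`-adic fields is unramified iff `m_K O_L = m_L`
(i.e. the ramification index is `1`; the residue extension is automatically separable). -/
def IsUnramifiedExt (K L : Type) [Field K] [Field L] [Algebra ℚ_[p] K] [Algebra ℚ_[p] L]
    [Algebra K L] [IsScalarTower ℚ_[p] K L] : Prop :=
  Ideal.map (intMap p K L) (maxIdeal p K) = maxIdeal p L

/-- An extension `L/K` of `p`-adic fields is totally ramified iff its residue degree is `1`,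
i.e. `O_L = O_K + m_L`. -/
def IsTotallyRamifiedExt (K L : Type) [Field K] [Field L] [Algebra ℚ_[p] K] [Algebra ℚ_[p] L]
    [Algebra K L] [IsScalarTower ℚ_[p] K L] : Prop :=
  ∀ x : O p L, ∃ y : O p K, x - intMap p K L y ∈ maxIdeal p L

/-- A witness that `α : K` acquires an `n`-th root in some unramified extension of `K`. -/
structure UnramifiedRootWitness (K : Type) [Field K] [Algebra ℚ_[p] K] (n : ℕ) (α : K) where
  L : Type
  [fieldL : Field L]
  [algQL : Algebra ℚ_[p] L]
  [algKL : Algebra K L]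
  [tower : IsScalarTower ℚ_[p] K L]
  [fin : FiniteDimensional ℚ_[p] L]
  β : L
  pow_eq : β ^ n = algebraMap K L α
  unram : IsUnramifiedExt p K L

/-- A unit `α` of `O_K` is `p`-primary if `K(α^{1/p})/K` is unramified, equivalently `α`
admits a `p`-th root in an unramified extension of `K`. -/
def IsPPrimary (K : Type) [Field K] [Algebra ℚ_[p] K] (α : K) : Prop :=
  IsIntegralUnit p K α ∧ Nonempty (UnramifiedRootWitness p K p α)

end PadicStmt

section

open Polynomial

theorem Submodule.mul_mem_span_singleton_pow {R A : Type*} [CommRing R] [CommRing A] [Algebra R A]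
    {a x y : A} {i j k : ℕ} (hk : k ≤ i + j) (ha : a ∈ Set.range (algebraMap R A))
    (hx : x ∈ R ∙ a ^ i) (hy : y ∈ R ∙ a ^ j) : x * y ∈ R ∙ a ^ k := by
  obtain ⟨r, rfl⟩ := Submodule.mem_span_singleton.1 hx
  obtain ⟨s, rfl⟩ := Submodule.mem_span_singleton.1 hy
  obtain ⟨t, rfl⟩ := ha
  obtain ⟨d, hd⟩ := Nat.exists_eq_add_of_le hk
  refine Submodule.mem_span_singleton.2 ⟨r * s * t ^ d, ?_⟩
  rw [smul_mul_smul_comm, ← pow_add, hd, pow_add, mul_smul, Algebra.smul_def (t ^ d), map_pow,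
    mul_comm (algebraMap R A t ^ d)]

theorem Submodule.mem_span_singleton_pow_of_natCast_mul_mem {R A : Type*} [CommRing R] [CommRing A]
    [Algebra R A] [IsDomain A] [CharZero A] {p : ℕ} (hp : p.Prime)
    (hunit : ∀ k : ℕ, ¬ p ∣ k → IsUnit (k : R)) {k i : ℕ} (hk : k ≠ 0) {x : A}
    (hx : (k : A) * x ∈ R ∙ (p : A) ^ (i + k.factorization p)) : x ∈ R ∙ (p : A) ^ i := by
  obtain ⟨r, hr⟩ := Submodule.mem_span_singleton.1 hx
  obtain ⟨w, hw⟩ := hunit (k / p ^ k.factorization p) (Nat.not_dvd_ordCompl hp hk)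
  refine Submodule.mem_span_singleton.2 ⟨(↑w⁻¹ : R) * r, ?_⟩
  have hp0 : (p : A) ^ k.factorization p ≠ 0 :=
    pow_ne_zero _ (Nat.cast_ne_zero.2 hp.ne_zero)
  have hkw : (k : A) = (p : A) ^ k.factorization p * algebraMap R A w := by
    rw [hw, map_natCast, ← Nat.cast_pow, ← Nat.cast_mul, Nat.ordProj_mul_ordCompl_eq_self]
  apply mul_left_cancel₀ hp0
  have hww : algebraMap R A (↑w⁻¹ : R) * algebraMap R A w = 1 := by
    rw [← map_mul, Units.inv_mul, map_one]
  rw [hkw, pow_add, Algebra.smul_def] at hr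
  rw [Algebra.smul_def, map_mul]
  linear_combination algebraMap R A (↑w⁻¹ : R) * hr +
    (p : A) ^ k.factorization p * x * hww

open Finset in
theorem pow_mul_aeval_esymm_mem_span_singleton_pow {R A σ : Type*} [CommRing R] [CommRing A]
    [Algebra R A] [IsDomain A] [CharZero A] [Fintype σ] {p m : ℕ} (hp : p.Prime)
    (hunit : ∀ k : ℕ, ¬ p ∣ k → IsUnit (k : R)) (f : σ → A)
    (hf : ∀ i, 0 < i → ∑ s, f s ^ i ∈ R ∙ (p : A) ^ m) {k : ℕ} (hk : 0 < k)
    (hkm : k < p ^ (m + 1)) :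
    (p : A) ^ k * MvPolynomial.aeval f (MvPolynomial.esymm σ ℤ k) ∈ R ∙ (p : A) ^ (m + 1) := by
  have hpR : (p : A) ∈ Set.range (algebraMap R A) := ⟨p, map_natCast _ p⟩
  have hself : ∀ i, (p : A) ^ i ∈ R ∙ (p : A) ^ i := fun i =>
    Submodule.mem_span_singleton_self _
  induction k using Nat.strong_induction_on with
  | _ k ih =>
  apply Submodule.mem_span_singleton_pow_of_natCast_mul_mem hp hunit hk.ne'
  have hv : k.factorization p < k := Nat.factorization_lt _ hk.ne'
  have hvm : k.factorization p ≤ m := by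
    have := (Nat.pow_le_of_le_log hk.ne' le_rfl : p ^ Nat.log p k ≤ k)
    have h1 : p ^ k.factorization p < p ^ (m + 1) :=
      (Nat.le_of_dvd hk (Nat.ordProj_dvd k p)).trans_lt hkm
    exact Nat.lt_succ_iff.1 ((Nat.pow_lt_pow_iff_right hp.one_lt).1 h1)
  have newton := congrArg (MvPolynomial.aeval f) (MvPolynomial.mul_esymm_eq_sum σ ℤ k)
  simp only [map_mul, map_natCast, map_pow, map_neg, map_one, map_sum] at newton
  rw [mul_left_comm, newton, mul_left_comm, mul_sum, ← Int.cast_one, ← Int.cast_neg,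
    ← Int.cast_pow, ← zsmul_eq_mul]
  refine Submodule.smul_of_tower_mem _ _ (Submodule.sum_mem _ fun a ha => ?_)
  obtain ⟨ha, hak⟩ := mem_filter.1 ha
  rw [HasAntidiagonal.mem_antidiagonal] at ha
  have hq : (p : A) ^ a.2 * MvPolynomial.aeval f (MvPolynomial.psum σ ℤ a.2) ∈
      R ∙ (p : A) ^ (a.2 + m) := by
    refine Submodule.mul_mem_span_singleton_pow le_rfl hpR (hself _) ?_
    simpa [MvPolynomial.psum] using hf a.2 (by omega)
  have hsplit : (p : A) ^ k * (((-1 : ℤ) : A) ^ a.1 *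
      MvPolynomial.aeval f (MvPolynomial.esymm σ ℤ a.1) *
      MvPolynomial.aeval f (MvPolynomial.psum σ ℤ a.2)) = ((-1 : ℤ) ^ a.1) •
      (((p : A) ^ a.1 * MvPolynomial.aeval f (MvPolynomial.esymm σ ℤ a.1)) *
      ((p : A) ^ a.2 * MvPolynomial.aeval f (MvPolynomial.psum σ ℤ a.2))) := by
    rw [zsmul_eq_mul, ← ha, pow_add]
    push_cast
    ring
  rw [hsplit]
  refine Submodule.smul_of_tower_mem _ _ ?_
  rcases Nat.eq_zero_or_pos a.1 with h0 | h0
  · rw [h0, pow_zero, MvPolynomial.esymm_zero, map_one, one_mul]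
    have := Submodule.mul_mem_span_singleton_pow (k := m + 1 + k.factorization p)
      (j := 0) (by omega) hpR hq (hself 0)
    simpa using this
  · exact Submodule.mul_mem_span_singleton_pow (by omega) hpR
      (ih a.1 hak h0 (by omega)) hq

theorem prod_one_sub_mul_sub_one_mem_span_singleton_pow {R A σ : Type*} [CommRing R] [CommRing A]
    [Algebra R A] [IsDomain A] [CharZero A] [Fintype σ] {p m : ℕ} (hp : p.Prime)
    (hunit : ∀ k : ℕ, ¬ p ∣ k → IsUnit (k : R)) (f : σ → A)
    (hf : ∀ i, 0 < i → ∑ s, f s ^ i ∈ R ∙ (p : A) ^ m) (hσ : Fintype.card σ < p ^ (m + 1)) :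
    ∏ s, (1 - p * f s) - 1 ∈ R ∙ (p : A) ^ (m + 1) := by
  classical
  have h : ∏ s, (1 - p * f s) = ∑ k ∈ Finset.range (Fintype.card σ + 1),
      (-1 : ℤ) ^ k • ((p : A) ^ k * MvPolynomial.aeval f (MvPolynomial.esymm σ ℤ k)) := by
    have h1 : ∀ s, 1 - (p : A) * f s = 1 + (-(p : A)) * f s := fun s => by ring
    simp_rw [h1, Finset.prod_one_add]
    rw [Finset.sum_powerset, Finset.card_univ]
    refine Finset.sum_congr rfl fun k _ => ?_
    rw [MvPolynomial.esymm, map_sum, Finset.mul_sum, Finset.smul_sum]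
    refine Finset.sum_congr rfl fun t ht => ?_
    rw [Finset.prod_mul_distrib, Finset.prod_const, (Finset.mem_powersetCard.1 ht).2, map_prod,
      neg_pow, zsmul_eq_mul]
    simp [mul_assoc]
  rw [h, Finset.sum_range_succ', MvPolynomial.esymm_zero]
  simp only [pow_zero, map_one, mul_one, one_smul, add_sub_cancel_right]
  refine Submodule.sum_mem _ fun k hk => Submodule.smul_of_tower_mem _ _ ?_
  exact pow_mul_aeval_esymm_mem_span_singleton_pow hp hunit f hf k.succ_pos
    (by have := Finset.mem_range.1 hk; omega)

theorem IsPrimitiveRoot.sum_nthRootsFinset_pow {A : Type*} [CommRing A] [IsDomain A] {N : ℕ}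
    [NeZero N] {μ : A} (hμ : IsPrimitiveRoot μ N) (j : ℕ) :
    ∑ x ∈ nthRootsFinset N (1 : A), x ^ j = if N ∣ j then (N : A) else 0 := by
  have hN : 0 < N := NeZero.pos N
  split_ifs with h
  · rw [Finset.sum_congr rfl (g := fun _ => (1 : A)), Finset.sum_const, hμ.card_nthRootsFinset,
      nsmul_one]
    intro x hx
    obtain ⟨d, rfl⟩ := h
    rw [pow_mul, (Polynomial.mem_nthRootsFinset hN _).1 hx, one_pow]
  · have key : μ ^ j * ∑ x ∈ nthRootsFinset N (1 : A), x ^ j =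
        ∑ x ∈ nthRootsFinset N (1 : A), x ^ j := by
      rw [Finset.mul_sum]
      refine Finset.sum_bij (fun x _ => μ * x) (fun x hx => ?_) (fun _ _ _ _ hxy => ?_)
        (fun y hy => ?_) (fun x _ => (mul_pow _ _ _).symm)
      · rw [Polynomial.mem_nthRootsFinset hN] at hx ⊢
        rw [mul_pow, hx, hμ.pow_eq_one, one_mul]
      · exact mul_left_cancel₀ (hμ.ne_zero hN.ne') hxy
      · have hμN : μ * μ ^ (N - 1) = 1 := by
          rw [← pow_succ', Nat.sub_add_cancel hN, hμ.pow_eq_one]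
        refine ⟨μ ^ (N - 1) * y, ?_, ?_⟩
        · rw [Polynomial.mem_nthRootsFinset hN] at hy ⊢
          rw [mul_pow, hy, ← pow_mul, mul_comm (N - 1), pow_mul, hμ.pow_eq_one, one_pow, one_mul]
        · rw [← mul_assoc, hμN, one_mul]
    have h1 : μ ^ j - 1 ≠ 0 := sub_ne_zero.2 fun h' => h (hμ.dvd_of_pow_eq_one _ h')
    refine (mul_eq_zero.1 ?_).resolve_left h1
    rw [sub_mul, key, one_mul, sub_self]

theorem IsPrimitiveRoot.sum_primitiveRoots_prime_pow_pow {A : Type*} [CommRing A] [IsDomain A]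
    {p : ℕ} [hp : Fact p.Prime] {n : ℕ} {μ : A} (hμ : IsPrimitiveRoot μ (p ^ (n + 1))) (j : ℕ) :
    ∑ x ∈ primitiveRoots (p ^ (n + 1)) A, x ^ j =
      (if p ^ (n + 1) ∣ j then (p : A) ^ (n + 1) else 0) - if p ^ n ∣ j then (p : A) ^ n else 0 := by
  classical
  have h0 : ∀ k, 0 < p ^ k := fun k => pow_pos hp.out.pos k
  have hν : IsPrimitiveRoot (μ ^ p) (p ^ n) := hμ.pow (h0 _) (pow_succ' p n)
  have hunion : nthRootsFinset (p ^ (n + 1)) (1 : A) =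
      primitiveRoots (p ^ (n + 1)) A ∪ nthRootsFinset (p ^ n) (1 : A) := by
    ext x
    rw [Finset.mem_union, Polynomial.mem_nthRootsFinset (h0 _), Polynomial.mem_nthRootsFinset (h0 _),
      mem_primitiveRoots (h0 _)]
    refine ⟨fun hx => or_iff_not_imp_right.2 fun hx' => ?_, fun hx => hx.elim (·.pow_eq_one) ?_⟩
    · rw [← orderOf_eq_prime_pow hx' hx]
      exact IsPrimitiveRoot.orderOf x
    · intro h
      rw [pow_succ, pow_mul, h, one_pow]
  have hdisj : Disjoint (primitiveRoots (p ^ (n + 1)) A) (nthRootsFinset (p ^ n) (1 : A)) := by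
    refine Finset.disjoint_left.2 fun x hx hx' => ?_
    rw [Polynomial.mem_nthRootsFinset (h0 _)] at hx'
    rw [mem_primitiveRoots (h0 _)] at hx
    exact absurd (Nat.le_of_dvd (h0 _) (hx.dvd_of_pow_eq_one _ hx'))
      (Nat.pow_lt_pow_right hp.out.one_lt n.lt_succ_self).not_ge
  have h1 := hμ.sum_nthRootsFinset_pow j
  rw [hunion, Finset.sum_union hdisj, hν.sum_nthRootsFinset_pow j] at h1
  push_cast at h1
  exact eq_sub_of_add_eq h1

theorem IsPrimitiveRoot.trace_prime_pow_pow {F K : Type*} [Field F] [Field K] [CharZero F] [Algebra F K] {p n : ℕ} [hp : Fact p.Prime]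
    [IsCyclotomicExtension {p ^ (n + 1)} F K] {ζ : K} (hζ : IsPrimitiveRoot ζ (p ^ (n + 1)))
    (hirr : Irreducible (cyclotomic (p ^ (n + 1)) F)) (j : ℕ) :
    Algebra.trace F K (ζ ^ j) =
      (if p ^ (n + 1) ∣ j then (p : F) ^ (n + 1) else 0) - if p ^ n ∣ j then (p : F) ^ n else 0 := by
  have := IsCyclotomicExtension.finiteDimensional {p ^ (n + 1)} F K
  let σ : K →ₐ[F] AlgebraicClosure F := IsAlgClosed.lift
  apply (algebraMap F (AlgebraicClosure F)).injective
  have hT := (hζ.map_of_injective σ.injective).sum_primitiveRoots_prime_pow_pow j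
  rw [trace_eq_sum_embeddings (AlgebraicClosure F)]
  trans ∑ x ∈ primitiveRoots (p ^ (n + 1)) (AlgebraicClosure F), x ^ j
  · rw [← Finset.sum_coe_sort (primitiveRoots _ _)]
    exact Fintype.sum_equiv (hζ.embeddingsEquivPrimitiveRoots _ hirr) _ _ fun τ => by simp
  · rw [hT]
    split_ifs <;> simp

theorem Polynomial.cyclotomic_prime_pow_comp_isEisensteinAt {R : Type*} [CommRing R] [IsDomain R]
    {p : ℕ} [hp : Fact p.Prime] (hpR : Prime (p : R)) (n : ℕ) :
    ((cyclotomic (p ^ (n + 1)) R).comp (X + 1)).IsEisensteinAt (Submodule.span R {(p : R)}) := by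
  have hZ := cyclotomic_prime_pow_comp_X_add_one_isEisensteinAt p n
  have hmap : (cyclotomic (p ^ (n + 1)) R).comp (X + 1) =
      ((cyclotomic (p ^ (n + 1)) ℤ).comp (X + 1)).map (Int.castRingHom R) := by
    simp [Polynomial.map_comp]
  have hmonic : ((cyclotomic (p ^ (n + 1)) ℤ).comp (X + 1)).Monic :=
    (cyclotomic.monic _ ℤ).comp (monic_X_add_C 1) (by rw [← C_1, natDegree_X_add_C]; exact one_ne_zero)
  refine ⟨?_, fun {k} hk => ?_, ?_⟩
  · rw [hmap, (hmonic.map _).leadingCoeff]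
    exact fun h => hpR.not_isUnit (isUnit_of_dvd_one (Ideal.mem_span_singleton.1 h))
  · rw [hmap, hmonic.natDegree_map] at hk
    obtain ⟨c, hc⟩ := Ideal.mem_span_singleton.1 (hZ.mem hk)
    rw [hmap, coeff_map, hc]
    exact Ideal.mem_span_singleton.2 ⟨c, by simp⟩
  · rw [coeff_zero_eq_eval_zero, eval_comp]
    simp only [eval_add, eval_X, eval_one, zero_add, eval_one_cyclotomic_prime_pow]
    intro h
    change (p : R) ∈ Ideal.span {(p : R)} ^ 2 at h
    rw [Ideal.span_singleton_pow, Ideal.mem_span_singleton] at h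
    obtain ⟨c, hc⟩ := h
    refine hpR.not_isUnit (isUnit_of_dvd_one ⟨c, mul_left_cancel₀ hpR.ne_zero ?_⟩)
    linear_combination hc

theorem Polynomial.irreducible_cyclotomic_prime_pow_of_prime {R F : Type*} [CommRing R] [IsDomain R]
    [IsIntegrallyClosed R] [Field F] [Algebra R F] [IsFractionRing R F]
    {p : ℕ} [hp : Fact p.Prime] (hpR : Prime (p : R)) (n : ℕ) :
    Irreducible (cyclotomic (p ^ (n + 1)) F) := by
  have hmonic : ((cyclotomic (p ^ (n + 1)) R).comp (X + 1)).Monic :=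
    (cyclotomic.monic _ R).comp (monic_X_add_C 1) (by rw [← C_1, natDegree_X_add_C]; exact one_ne_zero)
  have hcomp : (cyclotomic (p ^ (n + 1)) R).comp (X + 1) =
      algEquivAevalXAddC (1 : R) (cyclotomic (p ^ (n + 1)) R) := by
    simp [comp_eq_aeval]
  have hirr : Irreducible ((cyclotomic (p ^ (n + 1)) R).comp (X + 1)) := by
    refine (cyclotomic_prime_pow_comp_isEisensteinAt hpR n).irreducible
      ((Ideal.span_singleton_prime hpR.ne_zero).2 hpR) hmonic.isPrimitive ?_
    rw [natDegree_comp, show (X + 1 : R[X]) = X + C 1 by simp, natDegree_X_add_C, mul_one,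
      natDegree_cyclotomic]
    exact Nat.totient_pos.2 (pow_pos hp.out.pos _)
  rw [hcomp, MulEquiv.irreducible_iff] at hirr
  rw [← map_cyclotomic _ (algebraMap R F)]
  exact ((cyclotomic.monic _ R).irreducible_iff_irreducible_map_fraction_map (K := F)).1 hirr

theorem IsPrimitiveRoot.minpoly_sub_one_isEisensteinAt (F : Type*) {R K : Type*} [CommRing R] [IsDomain R]
    [IsIntegrallyClosed R] [Field F] [Algebra R F] [IsFractionRing R F] [CharZero F] [Field K]
    [Algebra F K] [Algebra R K] [IsScalarTower R F K] {p n : ℕ} [hp : Fact p.Prime]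
    [IsCyclotomicExtension {p ^ (n + 1)} F K] {ζ : K} (hζ : IsPrimitiveRoot ζ (p ^ (n + 1)))
    (hpR : Prime (p : R)) :
    (minpoly R (ζ - 1)).IsEisensteinAt (Submodule.span R {(p : R)}) := by
  have hirr := irreducible_cyclotomic_prime_pow_of_prime (F := F) hpR n
  have hint : IsIntegral R (ζ - 1) :=
    (hζ.isIntegral (pow_pos hp.out.pos _)).tower_top.sub isIntegral_one
  have h₁ := minpoly.isIntegrallyClosed_eq_field_fractions' F hint
  have h₂ := hζ.minpoly_sub_one_eq_cyclotomic_comp hirr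
  rw [h₁, ← map_cyclotomic _ (algebraMap R F),
    show (X + 1 : F[X]) = map (algebraMap R F) (X + 1) by simp, ← map_comp] at h₂
  rw [map_injective _ (IsFractionRing.injective R F) h₂]
  exact cyclotomic_prime_pow_comp_isEisensteinAt hpR n

theorem IsPrimitiveRoot.mem_adjoin_of_isIntegral (F : Type*) {R K : Type*} [CommRing R] [IsDomain R]
    [IsIntegrallyClosed R] [Field F] [Algebra R F] [IsFractionRing R F] [CharZero F] [Field K]
    [Algebra F K] [Algebra R K] [IsScalarTower R F K] {p n : ℕ} [hp : Fact p.Prime]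
    [IsCyclotomicExtension {p ^ (n + 1)} F K] {ζ : K} (hζ : IsPrimitiveRoot ζ (p ^ (n + 1)))
    (hpR : Prime (p : R)) {x : K} (hx : IsIntegral R x) :
    x ∈ Algebra.adjoin R {ζ - 1} := by
  have hirr := irreducible_cyclotomic_prime_pow_of_prime (F := F) hpR n
  let B := hζ.subOnePowerBasis F
  have hBg : B.gen = ζ - 1 := hζ.subOnePowerBasis_gen F
  have hintζ : IsIntegral R ζ := (hζ.isIntegral (pow_pos hp.out.pos _)).tower_top
  have hint : IsIntegral R B.gen := by
    rw [hBg]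
    exact hintζ.sub isIntegral_one
  have := IsCyclotomicExtension.finiteDimensional {p ^ (n + 1)} F K
  have H := Algebra.discr_mul_isIntegral_mem_adjoin F (B := hζ.powerBasis F)
    (by rwa [hζ.powerBasis_gen F]) hx
  obtain ⟨u, k, huk⟩ := IsCyclotomicExtension.discr_prime_pow_eq_unit_mul_pow hζ hirr
  rw [huk, hζ.powerBasis_gen F] at H
  have hle : Algebra.adjoin R {ζ} ≤ Algebra.adjoin R {ζ - 1} := by
    refine Algebra.adjoin_singleton_le ?_
    simpa using add_mem (Algebra.self_mem_adjoin_singleton R (ζ - 1)) (one_mem _)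
  have H' : (p : R) ^ k • x ∈ Algebra.adjoin R {ζ - 1} := by
    convert Subalgebra.zsmul_mem _ (hle H) (u⁻¹ : ℤˣ) using 1
    simp only [Algebra.smul_def, eq_intCast, map_mul, map_pow, map_natCast, map_intCast]
    rw [← mul_assoc, ← mul_assoc, ← Int.cast_mul, Units.inv_mul, Int.cast_one, one_mul]
  rw [← hBg] at H' ⊢
  refine mem_adjoin_of_smul_prime_pow_smul_of_minpoly_isEisensteinAt hpR hint hx H' ?_
  rw [hBg]
  exact hζ.minpoly_sub_one_isEisensteinAt F hpR

theorem IsPrimitiveRoot.trace_mem_span_pow {R F K : Type*} [CommRing R] [IsDomain R]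
    [IsIntegrallyClosed R] [Field F] [Algebra R F] [IsFractionRing R F] [CharZero F] [Field K]
    [Algebra F K] [Algebra R K] [IsScalarTower R F K] {p n : ℕ} [hp : Fact p.Prime]
    [IsCyclotomicExtension {p ^ (n + 1)} F K] {ζ : K} (hζ : IsPrimitiveRoot ζ (p ^ (n + 1)))
    (hpR : Prime (p : R)) {x : K} (hx : x ∈ Algebra.adjoin R {ζ}) :
    Algebra.trace F K x ∈ R ∙ (p : F) ^ n := by
  have hirr := irreducible_cyclotomic_prime_pow_of_prime (F := F) hpR n
  rw [Algebra.adjoin_singleton_eq_range_aeval] at hx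
  obtain ⟨f, rfl⟩ := hx
  change Algebra.trace F K (aeval ζ f) ∈ _
  rw [aeval_eq_sum_range, map_sum]
  refine Submodule.sum_mem _ fun j _ => ?_
  rw [← algebraMap_smul F, map_smul, algebraMap_smul, hζ.trace_prime_pow_pow hirr]
  refine Submodule.smul_mem _ _ (Submodule.sub_mem _ ?_ ?_) <;> split_ifs
  · exact Submodule.mem_span_singleton.2 ⟨p, by rw [Algebra.smul_def, map_natCast, pow_succ']⟩
  · exact Submodule.zero_mem _
  · exact Submodule.mem_span_singleton_self _
  · exact Submodule.zero_mem _

theorem IsPrimitiveRoot.trace_pow_sub_one_mul_mem_span_pow {R F K : Type*} [CommRing R] [IsDomain R]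
    [IsIntegrallyClosed R] [Field F] [Algebra R F] [IsFractionRing R F] [CharZero F] [Field K]
    [Algebra F K] [Algebra R K] [IsScalarTower R F K] {p n : ℕ} [hp : Fact p.Prime]
    [IsCyclotomicExtension {p ^ (n + 1)} F K] {ζ : K} (hζ : IsPrimitiveRoot ζ (p ^ (n + 1))) (hpR : Prime (p : R)) {x : K}
    (hx : x ∈ Algebra.adjoin R {ζ}) :
    Algebra.trace F K ((ζ ^ p ^ n - 1) * x) ∈ R ∙ (p : F) ^ (n + 1) := by
  have hirr := irreducible_cyclotomic_prime_pow_of_prime (F := F) hpR n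
  rw [Algebra.adjoin_singleton_eq_range_aeval] at hx
  obtain ⟨f, rfl⟩ := hx
  change Algebra.trace F K (_ * aeval ζ f) ∈ _
  rw [aeval_eq_sum_range, Finset.mul_sum, map_sum]
  refine Submodule.sum_mem _ fun j _ => ?_
  rw [mul_smul_comm, ← algebraMap_smul F, map_smul, algebraMap_smul, sub_mul, one_mul, ← pow_add,
    map_sub, hζ.trace_prime_pow_pow hirr, hζ.trace_prime_pow_pow hirr]
  refine Submodule.smul_mem _ _ ?_
  simp only [Nat.dvd_add_right (dvd_refl (p ^ n)), sub_sub_sub_cancel_right]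
  refine Submodule.sub_mem _ ?_ ?_ <;> split_ifs
  all_goals first | exact Submodule.zero_mem _ | exact Submodule.mem_span_singleton_self _

theorem IsPrimitiveRoot.trace_sub_one_pow_mul_mem_span_pow {R F K : Type*} [CommRing R] [IsDomain R]
    [IsIntegrallyClosed R] [Field F] [Algebra R F] [IsFractionRing R F] [CharZero F] [Field K]
    [Algebra F K] [Algebra R K] [IsScalarTower R F K] {p n : ℕ} [hp : Fact p.Prime]
    [IsCyclotomicExtension {p ^ (n + 1)} F K] {ζ : K} (hζ : IsPrimitiveRoot ζ (p ^ (n + 1))) (hpR : Prime (p : R)) {x : K}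
    (hx : x ∈ Algebra.adjoin R {ζ}) :
    Algebra.trace F K ((ζ - 1) ^ p ^ n * x) ∈ R ∙ (p : F) ^ (n + 1) := by
  let z : Algebra.adjoin R {ζ} := ⟨ζ, Algebra.self_mem_adjoin_singleton R ζ⟩
  obtain ⟨r, hr⟩ := exists_add_pow_prime_pow_eq hp.out (z - 1) 1 n
  have hr' : (ζ - 1) ^ p ^ n = (ζ ^ p ^ n - 1) - p * ((ζ - 1) * r) := by
    have := congrArg Subtype.val hr
    simp only [sub_add_cancel, one_pow, mul_one] at this
    push_cast at this
    change ζ ^ p ^ n = (ζ - 1) ^ p ^ n + 1 + p * (ζ - 1) * r at this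
    linear_combination -this
  have hmem : (ζ - 1) * r * x ∈ Algebra.adjoin R {ζ} :=
    mul_mem (mul_mem (z - 1).2 r.2) hx
  have hp' : Algebra.trace F K (p * ((ζ - 1) * r * x)) ∈ R ∙ (p : F) ^ (n + 1) := by
    obtain ⟨c, hc⟩ := Submodule.mem_span_singleton.1 (hζ.trace_mem_span_pow (F := F) hpR hmem)
    refine Submodule.mem_span_singleton.2 ⟨c, ?_⟩
    rw [← nsmul_eq_mul, map_nsmul, ← hc, pow_succ', ← nsmul_eq_mul, smul_comm]
  rw [hr', sub_mul, map_sub, mul_assoc]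
  exact Submodule.sub_mem _ (hζ.trace_pow_sub_one_mul_mem_span_pow hpR hx) hp'


theorem IsPrimitiveRoot.exists_isIntegral_sub_one_pow_eq {R K : Type*} [CommRing R] [IsDomain R]
    [Field K] [Algebra R K] {p n : ℕ} [hp : Fact p.Prime] [NeZero (p ^ (n + 1) : K)]
    {ζ : K} (hζ : IsPrimitiveRoot ζ (p ^ (n + 1))) (hpR : Prime (p : R)) :
    ∃ z : K, IsIntegral R z ∧ (ζ - 1) ^ (p ^ n * (p - 1)) = p * z := by
  have hmonic : ((cyclotomic (p ^ (n + 1)) R).comp (X + 1)).Monic :=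
    (cyclotomic.monic _ R).comp (monic_X_add_C 1)
      (by rw [← C_1, natDegree_X_add_C]; exact one_ne_zero)
  have hint : IsIntegral R (ζ - 1) :=
    (hζ.isIntegral (pow_pos hp.out.pos _)).tower_top.sub isIntegral_one
  have hroot : aeval (ζ - 1) ((cyclotomic (p ^ (n + 1)) R).comp (X + 1)) = 0 := by
    rw [aeval_comp, aeval_def, eval₂_eq_eval_map, map_cyclotomic]
    have : NeZero ((p ^ (n + 1) : ℕ) : K) := by simpa using ‹NeZero (p ^ (n + 1) : K)›
    simpa using isRoot_cyclotomic_iff.2 hζ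
  obtain ⟨z, hz, h⟩ := (cyclotomic_prime_pow_comp_isEisensteinAt hpR n).isWeaklyEisensteinAt
    |>.exists_mem_adjoin_mul_eq_pow_natDegree hroot hmonic
  refine ⟨z, adjoin_le_integralClosure hint hz, ?_⟩
  rw [hmonic.natDegree_map, natDegree_comp, show (X + 1 : R[X]) = X + C 1 by simp,
    natDegree_X_add_C, mul_one, natDegree_cyclotomic, Nat.totient_prime_pow_succ hp.out] at h
  rw [← h, map_natCast]

theorem IsPrimitiveRoot.jacobson_bot_le_span_sub_one (F : Type*) {R K : Type*} [CommRing R]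
    [IsDomain R] [IsIntegrallyClosed R] [Field F] [Algebra R F] [IsFractionRing R F] [CharZero F]
    [Field K] [Algebra F K] [Algebra R K] [IsScalarTower R F K] {p n : ℕ} [hp : Fact p.Prime]
    [IsCyclotomicExtension {p ^ (n + 1)} F K] {ζ : integralClosure R K}
    (hζ : IsPrimitiveRoot ζ (p ^ (n + 1))) (hpR : Prime (p : R))
    (hunit : ∀ a : R, ¬ (p : R) ∣ a → IsUnit a) :
    (⊥ : Ideal (integralClosure R K)).jacobson ≤ Ideal.span {ζ - 1} := by
  have hζK : IsPrimitiveRoot (ζ : K) (p ^ (n + 1)) :=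
    hζ.map_of_injective (f := (integralClosure R K).val) Subtype.val_injective
  by_cases htop : Ideal.span {ζ - 1} = ⊤
  · rw [htop]
    exact le_top
  have hpmem : (p : integralClosure R K) ∈ Ideal.span {ζ - 1} := by
    have : CharZero K := charZero_of_injective_algebraMap (algebraMap F K).injective
    have : NeZero ((p ^ (n + 1) : ℕ) : K) :=
      ⟨Nat.cast_ne_zero.2 (pow_ne_zero _ hp.out.ne_zero)⟩
    have hroot : (cyclotomic (p ^ (n + 1)) (integralClosure R K)).eval ζ = 0 := by
      apply Subtype.val_injective
      change (algebraMap (integralClosure R K) K) _ = 0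
      rw [← eval₂_at_apply, eval₂_eq_eval_map, map_cyclotomic]
      exact isRoot_cyclotomic_iff.2 hζK
    have h := sub_dvd_eval_sub ζ 1 (cyclotomic (p ^ (n + 1)) (integralClosure R K))
    rw [hroot, eval_one_cyclotomic_prime_pow, zero_sub, dvd_neg] at h
    exact Ideal.mem_span_singleton.2 h
  have hmax : (Ideal.span {ζ - 1}).IsMaximal := by
    refine Ideal.isMaximal_iff.2 ⟨(Ideal.ne_top_iff_one _).1 htop, fun J x hJ hx hxJ => ?_⟩
    have hxad := hζK.mem_adjoin_of_isIntegral F hpR x.2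
    rw [Algebra.adjoin_singleton_eq_range_aeval] at hxad
    obtain ⟨f, hf⟩ := hxad
    have hfx : aeval (ζ - 1) f = x := by
      apply Subtype.val_injective
      rw [← hf]
      exact (aeval_algebraMap_apply K (ζ - 1) f).symm
    have hdvd : ζ - 1 ∣ x - algebraMap R _ (f.coeff 0) := by
      have := map_dvd (aeval (ζ - 1)) (X_dvd_sub_C (p := f))
      rwa [aeval_X, map_sub, aeval_C, hfx] at this
    have hmem : x - algebraMap R _ (f.coeff 0) ∈ Ideal.span {ζ - 1} :=
      Ideal.mem_span_singleton.2 hdvd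
    have hu : IsUnit (f.coeff 0) := by
      refine hunit _ fun ⟨c, hc⟩ => hx ?_
      rw [hc, map_mul, map_natCast] at hmem
      simpa using add_mem hmem (Ideal.mul_mem_right (algebraMap R _ c) _ hpmem)
    have hJ' : algebraMap R (integralClosure R K) (f.coeff 0) ∈ J := by
      simpa using sub_mem hxJ (hJ hmem)
    exact (Ideal.eq_top_iff_one J).1 (Ideal.eq_top_of_isUnit_mem J hJ' (hu.map _))
  exact (Ideal.jacobson_mono bot_le).trans (Ideal.jacobson_eq_self_of_isMaximal).le

open Finset in
theorem IsPrimitiveRoot.norm_sub_one_mem_span_pow {R F K : Type*} [CommRing R]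
    [IsDomain R] [IsIntegrallyClosed R] [Field F] [Algebra R F] [IsFractionRing R F] [CharZero F]
    [Field K] [Algebra F K] [Algebra R K] [IsScalarTower R F K] {p n : ℕ} [hp : Fact p.Prime]
    [IsCyclotomicExtension {p ^ (n + 1)} F K] {ζ : K}
    (hζ : IsPrimitiveRoot ζ (p ^ (n + 1))) (hpR : Prime (p : R))
    (hunit : ∀ a : R, ¬ (p : R) ∣ a → IsUnit a) {y : integralClosure R K}
    (hy : y ∈ (⊥ : Ideal (integralClosure R K)).jacobson ^ p ^ (n + 1)) {u : K}
    (hu : 1 - u = y) :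
    Algebra.norm F u - 1 ∈ R ∙ (p : F) ^ (n + 2) := by
  have hirr := irreducible_cyclotomic_prime_pow_of_prime (F := F) hpR n
  have := IsCyclotomicExtension.finiteDimensional {p ^ (n + 1)} F K
  have : CharZero K := charZero_of_injective_algebraMap (algebraMap F K).injective
  have hpK : (p : K) ≠ 0 := Nat.cast_ne_zero.2 hp.out.ne_zero
  have : NeZero (p ^ (n + 1) : K) := ⟨pow_ne_zero _ hpK⟩
  have hζint : IsIntegral R ζ := (hζ.isIntegral (pow_pos hp.out.pos _)).tower_top
  let ζ' : integralClosure R K := ⟨ζ, hζint⟩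
  have hζ' : IsPrimitiveRoot ζ' (p ^ (n + 1)) :=
    IsPrimitiveRoot.of_map_of_injective (f := (integralClosure R K).val) hζ Subtype.val_injective
  have hy' := Ideal.pow_right_mono (hζ'.jacobson_bot_le_span_sub_one F hpR hunit) _ hy
  rw [Ideal.span_singleton_pow, Ideal.mem_span_singleton] at hy'
  obtain ⟨c, rfl⟩ := hy'
  obtain ⟨z, hz, hzp⟩ := hζ.exists_isIntegral_sub_one_pow_eq hpR
  have hadj : ∀ {x : K}, IsIntegral R x → x ∈ Algebra.adjoin R {ζ} := fun hx =>
    Algebra.adjoin_singleton_le (sub_mem (Algebra.self_mem_adjoin_singleton R ζ) (one_mem _))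
      (hζ.mem_adjoin_of_isIntegral F hpR hx)
  have hux : u = 1 - p * ((ζ - 1) ^ p ^ n * (z * c)) := by
    have hexp : p ^ (n + 1) = p ^ n * (p - 1) + p ^ n := by
      rw [← Nat.mul_succ, Nat.succ_eq_add_one, Nat.sub_add_cancel hp.out.one_le, pow_succ]
    have hc : 1 - u = (ζ - 1) ^ p ^ (n + 1) * (c : K) := hu
    rw [hexp, pow_add, hzp] at hc
    linear_combination -hc
  have hunitN : ∀ k : ℕ, ¬ p ∣ k → IsUnit (k : R) := fun k hk => by
    refine hunit _ fun hdvd => hpR.not_isUnit ?_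
    have hcop := (Nat.isCoprime_iff_coprime.2 ((hp.out.coprime_iff_not_dvd).2 hk)).map
      (Int.castRingHom R)
    simp only [eq_intCast, Int.cast_natCast] at hcop
    exact hcop.isUnit_of_dvd hdvd
  set w := (ζ - 1) ^ p ^ n * (z * c)
  have htrace : ∀ i, 0 < i → Algebra.trace F K (w ^ i) ∈ R ∙ (p : F) ^ (n + 1) := fun i hi => by
    obtain ⟨i, rfl⟩ := Nat.exists_eq_succ_of_ne_zero hi.ne'
    have hwi : w ^ (i + 1) = (ζ - 1) ^ p ^ n * (z * c * w ^ i) := by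
      rw [pow_succ', mul_assoc (_ ^ _) (z * c)]
    rw [hwi]
    refine hζ.trace_sub_one_pow_mul_mem_span_pow hpR (hadj ?_)
    have hzc : IsIntegral R (z * (c : K)) := hz.mul c.2
    exact hzc.mul ((((hζint.sub isIntegral_one).pow _).mul hzc).pow i)
  let Ω := AlgebraicClosure F
  have hmap : ∀ {x : F} {k : ℕ},
      algebraMap F Ω x ∈ R ∙ (p : Ω) ^ k ↔ x ∈ R ∙ (p : F) ^ k := fun {x k} => by
    simp only [Submodule.mem_span_singleton]
    refine exists_congr fun r => ?_
    rw [← (algebraMap F Ω).injective.eq_iff, Algebra.smul_def, Algebra.smul_def,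
      map_mul, ← IsScalarTower.algebraMap_apply, map_pow, map_natCast]
  have hcard : Fintype.card (K →ₐ[F] Ω) < p ^ (n + 1 + 1) := by
    rw [AlgHom.card, IsCyclotomicExtension.finrank K hirr]
    exact (Nat.totient_le _).trans_lt (Nat.pow_lt_pow_right hp.out.one_lt (Nat.lt_succ_self _))
  rw [← hmap, map_sub, Algebra.norm_eq_prod_embeddings, map_one, hux]
  simp only [map_sub, map_one, map_mul _ (p : K) w, map_natCast]
  refine prod_one_sub_mul_sub_one_mem_span_singleton_pow hp.out hunitN
    (fun σ : K →ₐ[F] Ω => σ w) (fun i hi => ?_) hcard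
  have := hmap.2 (htrace i hi)
  rw [trace_eq_sum_embeddings Ω] at this
  simpa only [map_pow] using this

end

open PadicStmt in
/-- Let `K = ℚ_p(ζ_{p^m})`, `m ≥ 1`.  Then
`N_{K/ℚ_p}(U_{p^m, K}) ⊆ U_{m+1, ℚ_p}`:  every unit `u` of `K` with `v_K(1-u) ≥ p^m`
satisfies `N_{K/ℚ_p}(u) ≡ 1 (mod p^{m+1})`. -/
theorem stmt10 (p : ℕ) [Fact p.Prime] (m : ℕ) (hm : 1 ≤ m)
    (K : Type) [Field K] [Algebra ℚ_[p] K] [FiniteDimensional ℚ_[p] K]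
    (ζ : K) (hζ : IsPrimitiveRoot ζ (p ^ m)) (hgen : Algebra.adjoin ℚ_[p] {ζ} = ⊤)
    (u : K) (hu : InU p K (p ^ m) u) :
    ‖Algebra.norm ℚ_[p] u - 1‖ ≤ (p : ℝ) ^ (-((m : ℤ) + 1)) := by
  obtain ⟨n, rfl⟩ : ∃ n, m = n + 1 := ⟨m - 1, by omega⟩
  have hcyc : IsCyclotomicExtension {p ^ (n + 1)} ℚ_[p] K := by
    refine (IsCyclotomicExtension.iff_singleton _ _ _).2 ⟨⟨ζ, hζ⟩, fun x => ?_⟩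
    have hx : x ∈ Algebra.adjoin ℚ_[p] {ζ} := hgen ▸ Algebra.mem_top
    have hsub : {ζ} ⊆ {b : K | b ^ p ^ (n + 1) = 1} :=
      Set.singleton_subset_iff.2 (Set.mem_setOf.2 hζ.pow_eq_one)
    exact Algebra.adjoin_mono hsub hx
  obtain ⟨-, y, hyu, hy⟩ := hu
  let : Algebra ℤ_[p] ℚ_[p] := PadicInt.algebra
  have : IsScalarTower ℤ_[p] ℚ_[p] K := IsScalarTower.of_algebraMap_eq fun _ => rfl
  have hunit : ∀ a : ℤ_[p], ¬ (p : ℤ_[p]) ∣ a → IsUnit a := fun a ha => by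
    rw [← PadicInt.norm_lt_one_iff_dvd, not_lt] at ha
    exact PadicInt.isUnit_iff.2 ((PadicInt.norm_le_one a).antisymm ha)
  have h := hζ.norm_sub_one_mem_span_pow (F := ℚ_[p]) PadicInt.prime_p hunit hy hyu.symm
  obtain ⟨r, hr⟩ := Submodule.mem_span_singleton.1 h
  rw [← hr, Algebra.smul_def, norm_mul, Padic.norm_p_pow]
  refine (mul_le_of_le_one_left (by positivity) (PadicInt.norm_le_one r)).trans_eq ?_
  push_cast
  ring_nf
end
end

section
/- Let p be a prime, m ≥ 2, and for 1 ≤ i ≤ m let K_i = ℚ_p(ζ_{p^i}) and r_i = (m−i+1)p^i − (m−i)p^{i−1}. Then for every i with 2 ≤ i ≤ m, N_{K_i/K_{i−1}}(U_{r_i, K_i}) ⊆ U_{r_{i−1}, K_{i−1}}; that is, every unit u of K_i with v_{K_i}(1−u) ≥ r_i has norm N_{K_i/K_{i−1}}(u) satisfying v_{K_{i−1}}(1 − N_{K_i/K_{i−1}}(u)) ≥ r_{i−1}. -/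
set_option synthInstance.maxHeartbeats 1000000
set_option maxHeartbeats 1000000
noncomputable section

section CyclotomicOrder

variable {R A : Type*} [CommRing R] [CommRing A] [Algebra R A] {p n : ℕ} {ζ : A}

theorem exists_sub_algebraMap_mem_span (hgen : Algebra.adjoin R {ζ} = ⊤) (x : A) :
    ∃ r : R, x - algebraMap R A r ∈ Ideal.span {1 - ζ} := by
  have hx : x ∈ Algebra.adjoin R {ζ} := hgen ▸ Algebra.mem_top
  induction hx using Algebra.adjoin_induction with
  | mem y hy =>
    rw [Set.mem_singleton_iff.1 hy]
    exact ⟨1, by rw [Ideal.mem_span_singleton]; exact ⟨-1, by simp⟩⟩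
  | algebraMap r => exact ⟨r, by simp⟩
  | add y z _ _ h₁ h₂ =>
    obtain ⟨⟨a, ha⟩, b, hb⟩ := And.intro h₁ h₂
    exact ⟨a + b, by simpa [add_sub_add_comm] using Ideal.add_mem _ ha hb⟩
  | mul y z _ _ h₁ h₂ =>
    obtain ⟨⟨a, ha⟩, b, hb⟩ := And.intro h₁ h₂
    refine ⟨a * b, ?_⟩
    have : y * z - algebraMap R A (a * b) =
        z * (y - algebraMap R A a) + algebraMap R A a * (z - algebraMap R A b) := by
      rw [map_mul]; ring
    rw [this]
    exact Ideal.add_mem _ (Ideal.mul_mem_left _ _ ha) (Ideal.mul_mem_left _ _ hb)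

variable [IsDomain A]

theorem associated_natCast_one_sub_pow_totient (hp : p.Prime)
    (hζ : IsPrimitiveRoot ζ (p ^ (n + 1))) :
    Associated (p : A) ((1 - ζ) ^ (p ^ (n + 1)).totient) := by
  have := Fact.mk hp
  have hprod : (p : A) = ∏ μ ∈ primitiveRoots (p ^ (n + 1)) A, (1 - μ) := by
    have h := Polynomial.eval_one_cyclotomic_prime_pow (R := A) (p := p) n
    rw [Polynomial.cyclotomic_eq_prod_X_sub_primitiveRoots hζ, Polynomial.eval_prod] at h
    simpa using h.symm
  rw [hprod, ← hζ.card_primitiveRoots, ← Finset.prod_const]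
  refine Associated.prod _ _ _ fun μ hμ => ?_
  have hpos : 0 < p ^ (n + 1) := pow_pos hp.pos _
  obtain ⟨k, -, hk, rfl⟩ := hζ.isPrimitiveRoot_iff.1 ((mem_primitiveRoots hpos).1 hμ)
  rw [← neg_sub ζ 1, ← neg_sub (ζ ^ k) 1]
  have : NeZero (p ^ (n + 1)) := ⟨hpos.ne'⟩
  exact (hζ.associated_sub_one_pow_sub_one_of_coprime hk).symm.neg_neg

variable [IsLocalRing R]

theorem eq_span_one_sub_of_isMaximal [Algebra.IsIntegral R A] (hp : p.Prime)
    (hR : IsLocalRing.maximalIdeal R = Ideal.span {(p : R)})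
    (hζ : IsPrimitiveRoot ζ (p ^ (n + 1))) (hgen : Algebra.adjoin R {ζ} = ⊤)
    (M : Ideal A) [hM : M.IsMaximal] : M = Ideal.span {1 - ζ} := by
  have hcomap : M.comap (algebraMap R A) = Ideal.span {(p : R)} := by
    rw [← hR]
    exact IsLocalRing.eq_maximalIdeal (Ideal.isMaximal_comap_of_isIntegral_of_isMaximal M)
  have hpA := associated_natCast_one_sub_pow_totient hp hζ
  have hpM : (p : A) ∈ M := by
    have : (p : R) ∈ M.comap (algebraMap R A) := hcomap ▸ Ideal.mem_span_singleton_self _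
    simpa using this
  have hπ : 1 - ζ ∈ M := hM.isPrime.mem_of_pow_mem _ (M.mem_of_dvd hpA.dvd hpM)
  have hle : Ideal.span {1 - ζ} ≤ M := by rwa [Ideal.span_singleton_le_iff_mem]
  refine le_antisymm (fun x hx => ?_) hle
  obtain ⟨r, hr⟩ := exists_sub_algebraMap_mem_span hgen x
  have hrM : r ∈ M.comap (algebraMap R A) := by
    have := M.sub_mem hx (hle hr)
    simpa using this
  rw [hcomap, Ideal.mem_span_singleton] at hrM
  obtain ⟨s, rfl⟩ := hrM
  have hp_mem : (p : A) ∈ Ideal.span {1 - ζ} := by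
    rw [Ideal.mem_span_singleton]
    refine (dvd_pow_self _ ?_).trans hpA.symm.dvd
    exact (Nat.totient_pos.2 (pow_pos hp.pos _)).ne'
  have := Ideal.add_mem _ hr (Ideal.mul_mem_right (algebraMap R A s) _ hp_mem)
  simpa using this

theorem isLocalRing_of_adjoin_eq_top [Algebra.IsIntegral R A] (hp : p.Prime)
    (hR : IsLocalRing.maximalIdeal R = Ideal.span {(p : R)})
    (hζ : IsPrimitiveRoot ζ (p ^ (n + 1))) (hgen : Algebra.adjoin R {ζ} = ⊤) :
    IsLocalRing A :=
  .of_unique_max_ideal <| by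
    obtain ⟨M, hM⟩ := Ideal.exists_maximal A
    refine ⟨M, hM, fun N hN => ?_⟩
    rw [eq_span_one_sub_of_isMaximal hp hR hζ hgen M,
      eq_span_one_sub_of_isMaximal hp hR hζ hgen N]

theorem isIntegrallyClosed_of_adjoin_eq_top [Algebra.IsIntegral R A] [IsNoetherianRing A]
    (hp : p.Prime) (hR : IsLocalRing.maximalIdeal R = Ideal.span {(p : R)})
    (hζ : IsPrimitiveRoot ζ (p ^ (n + 1))) (hgen : Algebra.adjoin R {ζ} = ⊤) :
    IsIntegrallyClosed A := by
  have := isLocalRing_of_adjoin_eq_top hp hR hζ hgen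
  have hprin : (IsLocalRing.maximalIdeal A).IsPrincipal :=
    ⟨1 - ζ, eq_span_one_sub_of_isMaximal hp hR hζ hgen _⟩
  have : IsPrincipalIdealRing A :=
    ((tfae_of_isNoetherianRing_of_isLocalRing_of_isDomain A).out 0 4).2 hprin
  infer_instance

end CyclotomicOrder

open Finset in
theorem exists_aeval_esymm_eq_natCast_mul {K L E : Type*} [Field K] [Field L] [Field E] [CharZero K]
    [Algebra K L] [Algebra K E] [FiniteDimensional K L] [IsAlgClosed E] {p : ℕ} (T : Subring K)
    (hT : ∀ k, 0 < k → k < p → (k : K)⁻¹ ∈ T) {y : L}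
    (htr : ∀ j, 0 < j → ∃ z ∈ T, Algebra.trace K L (y ^ j) = p * z) (k : ℕ) (hk : 0 < k)
    (hkp : k < p) :
    ∃ z ∈ T, MvPolynomial.aeval (fun σ : L →ₐ[K] E => σ y)
      (MvPolynomial.esymm (L →ₐ[K] E) K k) = algebraMap K E (p * z) := by
  induction k using Nat.strong_induction_on with
  | _ k ih =>
  have : CharZero E := charZero_of_injective_algebraMap (algebraMap K E).injective
  have hesymm : ∀ a < k, ∃ z ∈ T, MvPolynomial.aeval (fun σ : L →ₐ[K] E => σ y)
      (MvPolynomial.esymm (L →ₐ[K] E) K a) = algebraMap K E z := fun a ha => by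
    rcases a.eq_zero_or_pos with rfl | h0
    · exact ⟨1, T.one_mem, by simp⟩
    · obtain ⟨z, hz, h⟩ := ih a ha h0 (ha.trans hkp)
      exact ⟨p * z, T.mul_mem (natCast_mem T p) hz, h⟩
  have hsum : ∃ w ∈ T, MvPolynomial.aeval (fun σ : L →ₐ[K] E => σ y)
      (∑ a ∈ antidiagonal k with a.1 < k, (-1) ^ a.1 * MvPolynomial.esymm (L →ₐ[K] E) K a.1 *
        MvPolynomial.psum (L →ₐ[K] E) K a.2) = algebraMap K E (p * w) := by
    rw [map_sum]
    refine Finset.sum_induction _ (fun e => ∃ w ∈ T, e = algebraMap K E (p * w)) ?_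
      ⟨0, T.zero_mem, by simp⟩ ?_
    · rintro _ _ ⟨w, hw, rfl⟩ ⟨w', hw', rfl⟩
      exact ⟨w + w', T.add_mem hw hw', by rw [← map_add, mul_add]⟩
    · rintro ⟨a, b⟩ hab
      simp only [mem_filter, HasAntidiagonal.mem_antidiagonal] at hab
      obtain ⟨z, hz, hz'⟩ := hesymm a hab.2
      obtain ⟨t, ht, ht'⟩ := htr b (by omega)
      refine ⟨(-1) ^ a * z * t,
        T.mul_mem (T.mul_mem (pow_mem (neg_mem T.one_mem) _) hz) ht, ?_⟩
      have hpsum : MvPolynomial.aeval (fun σ : L →ₐ[K] E => σ y)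
          (MvPolynomial.psum (L →ₐ[K] E) K b) = algebraMap K E (p * t) := by
        rw [← ht', trace_eq_sum_embeddings E]
        simp [MvPolynomial.psum]
      simp only [map_mul, hz', hpsum, map_pow, map_neg, map_one]
      ring
  obtain ⟨w, hw, hw'⟩ := hsum
  have hnewton := congrArg (MvPolynomial.aeval (fun σ : L →ₐ[K] E => σ y))
    (MvPolynomial.mul_esymm_eq_sum (L →ₐ[K] E) K k)
  rw [map_mul, map_mul, hw', map_natCast] at hnewton
  refine ⟨(k : K)⁻¹ * (-1) ^ (k + 1) * w,
    T.mul_mem (T.mul_mem (hT k hk hkp) (pow_mem (neg_mem T.one_mem) _)) hw, ?_⟩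
  have hk0 : (k : E) ≠ 0 := Nat.cast_ne_zero.2 hk.ne'
  apply mul_left_cancel₀ hk0
  rw [hnewton]
  simp only [map_mul, map_pow, map_neg, map_one, map_inv₀, map_natCast]
  field_simp

open Finset in
theorem exists_norm_one_add_eq {K L : Type*} [Field K] [Field L] [CharZero K]
    [Algebra K L] [FiniteDimensional K L] {p : ℕ} (hp : 0 < p) (hfr : Module.finrank K L = p)
    (T : Subring K) (hT : ∀ k, 0 < k → k < p → (k : K)⁻¹ ∈ T) {y : L}
    (htr : ∀ j, 0 < j → ∃ z ∈ T, Algebra.trace K L (y ^ j) = p * z) {c : K} (hc : c ∈ T) :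
    ∃ z ∈ T, Algebra.norm K (1 + algebraMap K L c * y) =
      1 + p * c * z + c ^ p * Algebra.norm K y := by
  let E := AlgebraicClosure K
  choose! z hzT hz using exists_aeval_esymm_eq_natCast_mul (E := E) T hT htr
  have hcard : #(univ : Finset (L →ₐ[K] E)) = p := by
    rw [card_univ, AlgHom.card, hfr]
  have hsplit : range (p + 1) = insert 0 (insert p (Ioo 0 p)) := by
    ext; simp only [mem_range, mem_insert, mem_Ioo]; omega
  refine ⟨∑ k ∈ Ioo 0 p, c ^ (k - 1) * z k, sum_mem fun k hk => ?_, ?_⟩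
  · rw [mem_Ioo] at hk
    exact T.mul_mem (pow_mem hc _) (hzT k hk.1 hk.2)
  apply (algebraMap K E).injective
  have hmain : algebraMap K E (Algebra.norm K (1 + algebraMap K L c * y)) =
      ∑ k ∈ range (p + 1), algebraMap K E c ^ k *
        MvPolynomial.aeval (fun σ : L →ₐ[K] E => σ y) (MvPolynomial.esymm (L →ₐ[K] E) K k) := by
    rw [Algebra.norm_eq_prod_embeddings K E]
    simp only [map_add, map_one, map_mul, AlgHom.commutes]
    rw [prod_one_add, sum_powerset, hcard]
    refine sum_congr rfl fun k _ => ?_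
    simp only [MvPolynomial.esymm, map_sum, map_prod, MvPolynomial.aeval_X]
    rw [mul_sum]
    refine sum_congr rfl fun t ht => ?_
    rw [prod_mul_distrib, prod_const, (mem_powersetCard.1 ht).2]
  have hlast : MvPolynomial.aeval (fun σ : L →ₐ[K] E => σ y)
      (MvPolynomial.esymm (L →ₐ[K] E) K p) = algebraMap K E (Algebra.norm K y) := by
    rw [Algebra.norm_eq_prod_embeddings K E, MvPolynomial.esymm, ← hcard, powersetCard_self]
    simp
  rw [hmain, hsplit, sum_insert (by simp [hp.ne]), sum_insert (by simp), hlast]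
  have hmid : ∑ k ∈ Ioo 0 p, algebraMap K E c ^ k * MvPolynomial.aeval
      (fun σ : L →ₐ[K] E => σ y) (MvPolynomial.esymm (L →ₐ[K] E) K k) =
      algebraMap K E (p * c * ∑ k ∈ Ioo 0 p, c ^ (k - 1) * z k) := by
    rw [mul_sum, map_sum]
    refine sum_congr rfl fun k hk => ?_
    rw [mem_Ioo] at hk
    rw [hz k hk.1 hk.2, ← map_pow, ← map_mul]
    obtain ⟨l, rfl⟩ : ∃ l, k = l + 1 := ⟨k - 1, by omega⟩
    congr 1
    simp only [Nat.add_sub_cancel]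
    ring
  rw [hmid]
  simp only [map_add, map_one, map_mul, map_pow, MvPolynomial.esymm_zero]
  ring

theorem minpoly_eq_and_trace_eq_zero_of_pow_prime_eq {K L : Type*} [Field K] [Field L] [Algebra K L]
    [FiniteDimensional K L] {p : ℕ} (hp : p.Prime)
    (hroots : ∀ ω : L, ω ^ p = 1 → ω ∈ (algebraMap K L).fieldRange) {θ : L}
    (hθ : θ ∉ (algebraMap K L).fieldRange) {b : K} (hb : θ ^ p = algebraMap K L b) :
    minpoly K θ = Polynomial.X ^ p - Polynomial.C b ∧ Algebra.trace K L θ = 0 := by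
  have hirr : Irreducible (Polynomial.X ^ p - Polynomial.C b) := by
    refine X_pow_sub_C_irreducible_of_prime hp fun c hc => hθ ?_
    have hθ0 : θ ≠ 0 := fun h => hθ (h ▸ zero_mem _)
    have hc0 : algebraMap K L c ≠ 0 := fun h => by
      rw [← hc, map_pow, h, zero_pow hp.ne_zero] at hb
      exact hθ0 (pow_eq_zero_iff hp.ne_zero |>.1 hb)
    have h1 := hroots (θ / algebraMap K L c) (by
      rw [div_pow, hb, ← hc, map_pow, div_self (pow_ne_zero _ hc0)])
    have h2 := mul_mem h1 (RingHom.mem_fieldRange_self (algebraMap K L) c)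
    rwa [div_mul_cancel₀ _ hc0] at h2
  have hmin : minpoly K θ = Polynomial.X ^ p - Polynomial.C b :=
    (minpoly.eq_of_irreducible_of_monic hirr (by simp [hb])
      (Polynomial.monic_X_pow_sub_C b hp.ne_zero)).symm
  refine ⟨hmin, ?_⟩
  rw [trace_eq_finrank_mul_minpoly_nextCoeff, hmin, Polynomial.nextCoeff,
    Polynomial.natDegree_X_pow_sub_C, if_neg hp.ne_zero]
  have h1 := hp.one_lt
  rw [Polynomial.coeff_sub, Polynomial.coeff_X_pow, Polynomial.coeff_C,
    if_neg (by omega), if_neg (by omega)]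
  simp
theorem Subalgebra.adjoin_singleton_mk_eq_top {R A : Type*} [CommRing R] [CommRing A] [Algebra R A]
    {a : A} {S : Subalgebra R A} (hS : S = Algebra.adjoin R {a}) (ha : a ∈ S) :
    Algebra.adjoin R {(⟨a, ha⟩ : S)} = ⊤ := by
  subst hS
  rw [← Algebra.adjoin_adjoin_coe_preimage (R := R) (s := {a})]
  congr 1
  ext x
  simp [Subtype.ext_iff]

namespace PadicStmt

section CyclotomicField

variable {p : ℕ} [Fact p.Prime] {K : Type} [Field K] [Algebra ℚ_[p] K] {n : ℕ} {ζ : K}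

theorem isIntegral_of_isPrimitiveRoot (hζ : IsPrimitiveRoot ζ (p ^ (n + 1))) :
    IsIntegral ℤ_[p] ζ :=
  (hζ.isIntegral (pow_pos (Fact.out : p.Prime).pos _)).tower_top

theorem isIntegral_one_sub (hζ : IsPrimitiveRoot ζ (p ^ (n + 1))) : IsIntegral ℤ_[p] (1 - ζ) :=
  isIntegral_one.sub (isIntegral_of_isPrimitiveRoot hζ)

theorem isFractionRing_adjoin (hgen : Algebra.adjoin ℚ_[p] {ζ} = ⊤) :
    IsFractionRing (Algebra.adjoin ℤ_[p] {ζ}) K := by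
  refine IsFractionRing.of_field _ K fun z => ?_
  suffices ∃ x y : Algebra.adjoin ℤ_[p] {ζ}, (y : K) ≠ 0 ∧ z = x / y from
    let ⟨x, y, _, h⟩ := this
    ⟨x, y, h⟩
  have hz : z ∈ Algebra.adjoin ℚ_[p] {ζ} := hgen ▸ Algebra.mem_top
  induction hz using Algebra.adjoin_induction with
  | mem y hy => exact ⟨⟨y, Algebra.subset_adjoin hy⟩, 1, by simp, by simp⟩
  | algebraMap q =>
    obtain ⟨a, b, hb, rfl⟩ := IsFractionRing.div_surjective (A := ℤ_[p]) q
    refine ⟨algebraMap ℤ_[p] _ a, algebraMap ℤ_[p] _ b, ?_, ?_⟩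
    · have : algebraMap ℚ_[p] K (algebraMap ℤ_[p] ℚ_[p] b) ≠ 0 := by
        simpa using nonZeroDivisors.ne_zero hb
      exact this
    · rw [map_div₀]
      rfl
  | add y z _ _ h₁ h₂ =>
    obtain ⟨a, b, hb, rfl⟩ := h₁
    obtain ⟨c, d, hd, rfl⟩ := h₂
    exact ⟨a * d + b * c, b * d, by simp [hb, hd], by push_cast; rw [div_add_div _ _ hb hd]⟩
  | mul y z _ _ h₁ h₂ =>
    obtain ⟨a, b, hb, rfl⟩ := h₁
    obtain ⟨c, d, hd, rfl⟩ := h₂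
    exact ⟨a * c, b * d, by simp [hb, hd], by push_cast; rw [div_mul_div_comm]⟩

theorem integralClosure_eq_adjoin (hζ : IsPrimitiveRoot ζ (p ^ (n + 1)))
    (hgen : Algebra.adjoin ℚ_[p] {ζ} = ⊤) : O p K = Algebra.adjoin ℤ_[p] {ζ} := by
  have hp : p.Prime := Fact.out
  have hint := isIntegral_of_isPrimitiveRoot hζ
  set A := Algebra.adjoin ℤ_[p] {ζ} with hA
  have hfin : Module.Finite ℤ_[p] A :=
    Module.Finite.iff_fg.2 hint.fg_adjoin_singleton
  have : Algebra.IsIntegral ℤ_[p] A := Algebra.IsIntegral.of_finite _ _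
  have : IsNoetherianRing A := isNoetherian_of_tower ℤ_[p] inferInstance
  have hmem : ζ ∈ A := Algebra.self_mem_adjoin_singleton _ _
  have hζA : IsPrimitiveRoot (⟨ζ, hmem⟩ : A) (p ^ (n + 1)) :=
    IsPrimitiveRoot.of_map_of_injective (f := A.val) hζ Subtype.val_injective
  have := isIntegrallyClosed_of_adjoin_eq_top hp PadicInt.maximalIdeal_eq_span_p hζA
    (Subalgebra.adjoin_singleton_mk_eq_top hA hmem)
  have := isFractionRing_adjoin hgen
  refine le_antisymm (fun x hx => ?_) (Algebra.adjoin_le (Set.singleton_subset_iff.2 hint))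
  obtain ⟨y, rfl⟩ := IsIntegrallyClosed.isIntegral_iff.1 (IsIntegral.tower_top (A := A) hx)
  exact y.2

/-- The primitive root `ζ` as an element of the ring of integers. -/
def intRoot (hζ : IsPrimitiveRoot ζ (p ^ (n + 1))) : O p K :=
  ⟨ζ, isIntegral_of_isPrimitiveRoot hζ⟩

theorem isPrimitiveRoot_intRoot (hζ : IsPrimitiveRoot ζ (p ^ (n + 1))) :
    IsPrimitiveRoot (intRoot hζ) (p ^ (n + 1)) :=
  IsPrimitiveRoot.of_map_of_injective (f := (O p K).val) hζ Subtype.val_injective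

theorem isLocalRing_integers (hζ : IsPrimitiveRoot ζ (p ^ (n + 1)))
    (hgen : Algebra.adjoin ℚ_[p] {ζ} = ⊤) : IsLocalRing (O p K) :=
  isLocalRing_of_adjoin_eq_top Fact.out PadicInt.maximalIdeal_eq_span_p
    (isPrimitiveRoot_intRoot hζ)
    (Subalgebra.adjoin_singleton_mk_eq_top (integralClosure_eq_adjoin hζ hgen) _)

theorem eq_span_of_isMaximal_integers (hζ : IsPrimitiveRoot ζ (p ^ (n + 1)))
    (hgen : Algebra.adjoin ℚ_[p] {ζ} = ⊤) (M : Ideal (O p K)) [M.IsMaximal] :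
    M = Ideal.span {1 - intRoot hζ} :=
  eq_span_one_sub_of_isMaximal Fact.out PadicInt.maximalIdeal_eq_span_p
    (isPrimitiveRoot_intRoot hζ)
    (Subalgebra.adjoin_singleton_mk_eq_top (integralClosure_eq_adjoin hζ hgen) _) M

theorem maxIdeal_eq_span (hζ : IsPrimitiveRoot ζ (p ^ (n + 1)))
    (hgen : Algebra.adjoin ℚ_[p] {ζ} = ⊤) : maxIdeal p K = Ideal.span {1 - intRoot hζ} := by
  have := isLocalRing_integers hζ hgen
  rw [maxIdeal, IsLocalRing.jacobson_eq_maximalIdeal ⊥ bot_ne_top]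
  exact eq_span_of_isMaximal_integers hζ hgen _

theorem valGE_iff (hζ : IsPrimitiveRoot ζ (p ^ (n + 1)))
    (hgen : Algebra.adjoin ℚ_[p] {ζ} = ⊤) {k : ℕ} {x : K} :
    ValGE p K k x ↔ ∃ y, IsIntegral ℤ_[p] y ∧ x = (1 - ζ) ^ k * y := by
  rw [ValGE, maxIdeal_eq_span hζ hgen]
  simp only [Ideal.span_singleton_pow, Ideal.mem_span_singleton]
  constructor
  · rintro ⟨_, rfl, y, rfl⟩
    exact ⟨y, y.2, rfl⟩
  · rintro ⟨y, hy, rfl⟩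
    exact ⟨(1 - intRoot hζ) ^ k * ⟨y, hy⟩, rfl, _, rfl⟩

theorem exists_natCast_eq_one_sub_pow_mul (hζ : IsPrimitiveRoot ζ (p ^ (n + 1))) :
    ∃ v, IsIntegral ℤ_[p] v ∧ (p : K) = (1 - ζ) ^ (p ^ (n + 1)).totient * v := by
  obtain ⟨v, hv⟩ := (associated_natCast_one_sub_pow_totient (Fact.out : p.Prime)
    (isPrimitiveRoot_intRoot hζ)).symm.dvd
  exact ⟨v, v.2, by simpa [intRoot] using congrArg (Subtype.val : O p K → K) hv⟩

theorem not_isIntegral_inv_one_sub (hζ : IsPrimitiveRoot ζ (p ^ (n + 1)))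
    (hgen : Algebra.adjoin ℚ_[p] {ζ} = ⊤) : ¬ IsIntegral ℤ_[p] (1 - ζ)⁻¹ := fun h => by
  have hp : p.Prime := Fact.out
  have := isLocalRing_integers hζ hgen
  have hne : 1 - ζ ≠ 0 := sub_ne_zero.2 (hζ.ne_one (Nat.one_lt_pow n.succ_ne_zero hp.one_lt)).symm
  have hmem : 1 - intRoot hζ ∈ IsLocalRing.maximalIdeal (O p K) := by
    rw [eq_span_of_isMaximal_integers hζ hgen (IsLocalRing.maximalIdeal (O p K))]
    exact Ideal.mem_span_singleton_self _
  exact (IsLocalRing.mem_maximalIdeal _).1 hmem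
    (IsUnit.of_mul_eq_one ⟨_, h⟩ (Subtype.ext (mul_inv_cancel₀ hne)))

theorem exists_eq_one_sub_mul_or_isIntegral_inv (hζ : IsPrimitiveRoot ζ (p ^ (n + 1)))
    (hgen : Algebra.adjoin ℚ_[p] {ζ} = ⊤) {x : K} (hx : IsIntegral ℤ_[p] x) :
    (∃ y, IsIntegral ℤ_[p] y ∧ x = (1 - ζ) * y) ∨ IsIntegral ℤ_[p] x⁻¹ := by
  have := isLocalRing_integers hζ hgen
  by_cases h : IsUnit (⟨x, hx⟩ : O p K)
  · obtain ⟨y, hy⟩ := h.exists_right_inv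
    right
    rw [← eq_inv_of_mul_eq_one_right (congrArg (Subtype.val : O p K → K) hy)]
    exact y.2
  · have hmem := (IsLocalRing.mem_maximalIdeal _).2 h
    rw [eq_span_of_isMaximal_integers hζ hgen (IsLocalRing.maximalIdeal (O p K)),
      Ideal.mem_span_singleton] at hmem
    obtain ⟨y, hy⟩ := hmem
    exact Or.inl ⟨y, y.2, congrArg (Subtype.val : O p K → K) hy⟩

end CyclotomicField

section CyclotomicTower

variable {p : ℕ} [Fact p.Prime] {K L : Type} [Field K] [Field L] [Algebra K L]
  {n : ℕ} {ξ : K} {ζ : L}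

theorem mem_fieldRange_of_pow_eq_one (hξ : IsPrimitiveRoot ξ (p ^ (n + 1))) {ω : L}
    (hω : ω ^ p ^ (n + 1) = 1) : ω ∈ (algebraMap K L).fieldRange := by
  have : NeZero (p ^ (n + 1)) := ⟨(pow_pos (Fact.out : p.Prime).pos _).ne'⟩
  obtain ⟨k, -, rfl⟩ :=
    (hξ.map_of_injective (algebraMap K L).injective).eq_pow_of_pow_eq_one hω
  exact pow_mem (RingHom.mem_fieldRange_self (algebraMap K L) ξ) k

theorem pow_prime_mem_fieldRange (hξ : IsPrimitiveRoot ξ (p ^ (n + 1)))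
    (hζ : IsPrimitiveRoot ζ (p ^ (n + 2))) : ζ ^ p ∈ (algebraMap K L).fieldRange :=
  mem_fieldRange_of_pow_eq_one hξ (by rw [← pow_mul, ← pow_succ', hζ.pow_eq_one])

variable [Algebra ℚ_[p] L]

theorem exists_one_sub_pow_eq_one_sub_pow_add {x : L} (hx : IsIntegral ℤ_[p] x) :
    ∃ z, IsIntegral ℤ_[p] z ∧ 1 - x ^ p = (1 - x) ^ p + p * z := by
  have hp : p.Prime := Fact.out
  let X : O p L := ⟨x, hx⟩
  obtain ⟨r, hr⟩ := exists_add_pow_prime_eq hp (1 - X) X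
  have h : (1 - x + x) ^ p = (1 - x) ^ p + x ^ p + p * (1 - x) * x * r :=
    congrArg (Subtype.val : O p L → L) hr
  refine ⟨(1 - x) * x * r, ((isIntegral_one.sub hx).mul hx).mul r.2, ?_⟩
  rw [sub_add_cancel, one_pow] at h
  linear_combination h

theorem exists_one_sub_pow_eq_one_sub_mul {M : Type} [Field M] [Algebra ℚ_[p] M] {x : M}
    (hx : IsIntegral ℤ_[p] x) (k : ℕ) :
    ∃ z, IsIntegral ℤ_[p] z ∧ 1 - x ^ k = (1 - x) * z :=
  ⟨∑ i ∈ Finset.range k, x ^ i, IsIntegral.sum _ fun i _ => hx.pow i,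
    (mul_neg_geom_sum x k).symm⟩

theorem exists_one_sub_pow_eq_algebraMap_mul (hξ : IsPrimitiveRoot ξ (p ^ (n + 1)))
    (hζ : IsPrimitiveRoot ζ (p ^ (n + 2))) :
    ∃ z, IsIntegral ℤ_[p] z ∧ (1 - ζ) ^ p = algebraMap K L (1 - ξ) * z := by
  have hp : p.Prime := Fact.out
  have : NeZero (p ^ (n + 1)) := ⟨(pow_pos hp.pos _).ne'⟩
  obtain ⟨z, hz, h⟩ := exists_one_sub_pow_eq_one_sub_pow_add (isIntegral_of_isPrimitiveRoot hζ)
  have hξL := hξ.map_of_injective (algebraMap K L).injective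
  obtain ⟨k, -, hk⟩ := hξL.eq_pow_of_pow_eq_one (ξ := ζ ^ p)
    (by rw [← pow_mul, ← pow_succ', hζ.pow_eq_one])
  obtain ⟨t, ht, h'⟩ :=
    exists_one_sub_pow_eq_one_sub_mul (isIntegral_of_isPrimitiveRoot hξL) k
  obtain ⟨v, hv, hpv⟩ := exists_natCast_eq_one_sub_pow_mul hξL
  obtain ⟨e, he⟩ := Nat.exists_eq_succ_of_ne_zero
    (Nat.totient_pos.2 (pow_pos hp.pos (n + 1))).ne'
  refine ⟨t - (1 - algebraMap K L ξ) ^ e * v * z,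
    ht.sub ((((isIntegral_one_sub hξL).pow e).mul hv).mul hz), ?_⟩
  rw [hk] at h'
  rw [he, pow_succ] at hpv
  rw [map_sub, map_one]
  linear_combination h' - h - z * hpv

theorem exists_algebraMap_eq_one_sub_pow_mul (hξ : IsPrimitiveRoot ξ (p ^ (n + 1)))
    (hζ : IsPrimitiveRoot ζ (p ^ (n + 2))) :
    ∃ z, IsIntegral ℤ_[p] z ∧ algebraMap K L (1 - ξ) = (1 - ζ) ^ p * z := by
  have hp : p.Prime := Fact.out
  have : NeZero (p ^ (n + 1)) := ⟨(pow_pos hp.pos _).ne'⟩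
  have hζi := isIntegral_of_isPrimitiveRoot hζ
  obtain ⟨z, hz, h⟩ := exists_one_sub_pow_eq_one_sub_pow_add hζi
  have hξL := hξ.map_of_injective (algebraMap K L).injective
  have hζp : IsPrimitiveRoot (ζ ^ p) (p ^ (n + 1)) :=
    hζ.pow (pow_pos hp.pos _) (by rw [← pow_succ'])
  obtain ⟨k, -, hk⟩ := hζp.eq_pow_of_pow_eq_one hξL.pow_eq_one
  obtain ⟨t, ht, h'⟩ := exists_one_sub_pow_eq_one_sub_mul (hζi.pow p) k
  obtain ⟨v, hv, hpv⟩ := exists_natCast_eq_one_sub_pow_mul hζ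
  have hle : p ≤ (p ^ (n + 1 + 1)).totient := by
    rw [Nat.totient_prime_pow_succ hp]
    calc p = p ^ 1 * 1 := by simp
      _ ≤ p ^ (n + 1) * (p - 1) :=
        Nat.mul_le_mul (Nat.pow_le_pow_right hp.pos (by omega)) (by have := hp.two_le; omega)
  obtain ⟨e, he⟩ := Nat.exists_eq_add_of_le hle
  refine ⟨(1 + (1 - ζ) ^ e * v * z) * t,
    (isIntegral_one.add ((((isIntegral_one_sub hζ).pow e).mul hv).mul hz)).mul ht, ?_⟩
  rw [hk] at h'
  rw [he, pow_add] at hpv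
  rw [map_sub, map_one]
  linear_combination h' + t * h + t * z * hpv

variable [Algebra ℚ_[p] K] [IsScalarTower ℚ_[p] K L]

theorem isIntegral_algebraMap_iff_integral {x : K} :
    IsIntegral ℤ_[p] (algebraMap K L x) ↔ IsIntegral ℤ_[p] x :=
  isIntegral_algebraMap_iff (algebraMap K L).injective

theorem notMem_fieldRange (hξ : IsPrimitiveRoot ξ (p ^ (n + 1)))
    (hξgen : Algebra.adjoin ℚ_[p] {ξ} = ⊤) (hζ : IsPrimitiveRoot ζ (p ^ (n + 2)))
    (hζgen : Algebra.adjoin ℚ_[p] {ζ} = ⊤) : ζ ∉ (algebraMap K L).fieldRange := by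
  rintro ⟨ζ₀, rfl⟩
  have hp : p.Prime := Fact.out
  have hζ₀ := hζ.of_map_of_injective (algebraMap K L).injective
  have hnot := not_isIntegral_inv_one_sub hζ hζgen
  rcases exists_eq_one_sub_mul_or_isIntegral_inv hξ hξgen (isIntegral_one_sub hζ₀) with
    ⟨y, hy, h⟩ | h
  · obtain ⟨z, hz, h'⟩ := exists_algebraMap_eq_one_sub_pow_mul hξ hζ
    have hne : 1 - algebraMap K L ζ₀ ≠ 0 :=
      sub_ne_zero.2 (hζ.ne_one (Nat.one_lt_pow (by omega) hp.one_lt)).symm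
    obtain ⟨e, rfl⟩ : ∃ e, p = e + 2 := ⟨p - 2, by have := hp.two_le; omega⟩
    apply hnot
    have key : (1 - algebraMap K L ζ₀)⁻¹ =
        (1 - algebraMap K L ζ₀) ^ e * z * algebraMap K L y := by
      refine inv_eq_of_mul_eq_one_right ?_
      apply mul_left_cancel₀ hne
      have h1 := congrArg (algebraMap K L) h
      rw [map_mul, h', map_sub, map_one] at h1
      rw [mul_one]
      linear_combination -h1
    rw [key]
    exact (((isIntegral_one_sub hζ).pow e).mul hz).mul
      (isIntegral_algebraMap_iff_integral.2 hy)
  · apply hnot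
    rw [← map_one (algebraMap K L), ← map_sub, ← map_inv₀]
    exact isIntegral_algebraMap_iff_integral.2 h

theorem trace_pow_eq_zero [FiniteDimensional K L] (hξ : IsPrimitiveRoot ξ (p ^ (n + 1)))
    (hξgen : Algebra.adjoin ℚ_[p] {ξ} = ⊤) (hζ : IsPrimitiveRoot ζ (p ^ (n + 2)))
    (hζgen : Algebra.adjoin ℚ_[p] {ζ} = ⊤) {k : ℕ} (hk : ¬ p ∣ k) :
    Algebra.trace K L (ζ ^ k) = 0 := by
  have hp : p.Prime := Fact.out
  obtain ⟨b, hb⟩ := pow_prime_mem_fieldRange hξ hζ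
  refine (minpoly_eq_and_trace_eq_zero_of_pow_prime_eq hp (fun ω hω => ?_) (fun hmem => ?_) (b := b ^ k) ?_).2
  · refine mem_fieldRange_of_pow_eq_one hξ ?_
    rw [pow_succ', pow_mul, hω, one_pow]
  · obtain ⟨m, hm⟩ := exists_pow_eq_self_of_coprime (x := ζ) (n := k) (by
      rw [← hζ.eq_orderOf]
      exact (((Nat.Prime.coprime_iff_not_dvd hp).2 hk).pow_left _).symm)
    exact notMem_fieldRange hξ hξgen hζ hζgen (hm ▸ pow_mem hmem m)
  · rw [map_pow, hb, ← pow_mul, ← pow_mul, mul_comm]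

theorem finrank_eq_prime [FiniteDimensional K L] (hξ : IsPrimitiveRoot ξ (p ^ (n + 1)))
    (hξgen : Algebra.adjoin ℚ_[p] {ξ} = ⊤) (hζ : IsPrimitiveRoot ζ (p ^ (n + 2)))
    (hζgen : Algebra.adjoin ℚ_[p] {ζ} = ⊤) : Module.finrank K L = p := by
  have hp : p.Prime := Fact.out
  obtain ⟨b, hb⟩ := pow_prime_mem_fieldRange hξ hζ
  have hmin := (minpoly_eq_and_trace_eq_zero_of_pow_prime_eq hp (fun ω hω =>
    mem_fieldRange_of_pow_eq_one hξ (by rw [pow_succ', pow_mul, hω, one_pow]))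
    (notMem_fieldRange hξ hξgen hζ hζgen) hb.symm).1
  have htop : IntermediateField.adjoin K {ζ} = ⊤ := by
    refine eq_top_iff.2 fun x _ => ?_
    have hx : x ∈ Algebra.adjoin ℚ_[p] {ζ} := hζgen ▸ Algebra.mem_top
    have hle : Algebra.adjoin ℚ_[p] {ζ} ≤
        (IntermediateField.adjoin K {ζ}).toSubalgebra.restrictScalars ℚ_[p] :=
      Algebra.adjoin_le (IntermediateField.subset_adjoin K {ζ})
    exact hle hx
  rw [← IntermediateField.finrank_top', ← htop,
    IntermediateField.adjoin.finrank (Algebra.IsIntegral.isIntegral ζ), hmin,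
    Polynomial.natDegree_X_pow_sub_C]

theorem exists_trace_eq_natCast_mul [FiniteDimensional K L]
    (hξ : IsPrimitiveRoot ξ (p ^ (n + 1)))
    (hξgen : Algebra.adjoin ℚ_[p] {ξ} = ⊤) (hζ : IsPrimitiveRoot ζ (p ^ (n + 2)))
    (hζgen : Algebra.adjoin ℚ_[p] {ζ} = ⊤) {y : L} (hy : IsIntegral ℤ_[p] y) :
    ∃ z, IsIntegral ℤ_[p] z ∧ Algebra.trace K L y = p * z := by
  have hy' : y ∈ O p L := hy
  rw [integralClosure_eq_adjoin hζ hζgen, Algebra.adjoin_singleton_eq_range_aeval] at hy'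
  obtain ⟨f, rfl⟩ := hy'
  clear hy
  obtain ⟨b, hb⟩ := pow_prime_mem_fieldRange hξ hζ
  have hbi : IsIntegral ℤ_[p] b := isIntegral_algebraMap_iff_integral.1
    (hb ▸ (isIntegral_of_isPrimitiveRoot hζ).pow p)
  induction f using Polynomial.induction_on' with
  | add f g hf hg =>
    obtain ⟨z, hz, h⟩ := hf
    obtain ⟨w, hw, h'⟩ := hg
    refine ⟨z + w, hz.add hw, ?_⟩
    simp only [RingHom.coe_coe, AlgHom.toRingHom_eq_coe] at h h' ⊢
    rw [map_add, map_add, h, h', mul_add]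
  | monomial k a =>
    simp only [RingHom.coe_coe, AlgHom.toRingHom_eq_coe]
    rw [Polynomial.aeval_monomial, IsScalarTower.algebraMap_apply ℤ_[p] K L, ← Algebra.smul_def,
      map_smul]
    by_cases hk : p ∣ k
    · obtain ⟨k, rfl⟩ := hk
      refine ⟨algebraMap ℤ_[p] K a * b ^ k, isIntegral_algebraMap.mul (hbi.pow k), ?_⟩
      rw [pow_mul, ← hb, ← map_pow, Algebra.trace_algebraMap,
        finrank_eq_prime hξ hξgen hζ hζgen, smul_eq_mul, nsmul_eq_mul]
      ring
    · exact ⟨0, isIntegral_zero, by rw [trace_pow_eq_zero hξ hξgen hζ hζgen hk]; simp⟩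

theorem isIntegral_inv_natCast {M : Type} [Field M] [Algebra ℚ_[p] M] {k : ℕ} (hk : 0 < k)
    (hkp : k < p) : IsIntegral ℤ_[p] ((k : M)⁻¹) := by
  have hp : p.Prime := Fact.out
  have hunit : IsUnit (k : ℤ_[p]) := by
    rw [PadicInt.isUnit_iff, PadicInt.norm_natCast_eq_one_iff]
    exact Nat.coprime_of_lt_prime hk.ne' hkp hp
  obtain ⟨r, hr⟩ := hunit.exists_right_inv
  have h := congrArg (algebraMap ℤ_[p] M) hr
  rw [map_mul, map_natCast, map_one] at h
  rw [← eq_inv_of_mul_eq_one_right h]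
  exact isIntegral_algebraMap

theorem exists_norm_one_add_algebraMap_mul_eq [FiniteDimensional K L]
    (hξ : IsPrimitiveRoot ξ (p ^ (n + 1)))
    (hξgen : Algebra.adjoin ℚ_[p] {ξ} = ⊤) (hζ : IsPrimitiveRoot ζ (p ^ (n + 2)))
    (hζgen : Algebra.adjoin ℚ_[p] {ζ} = ⊤) {c : K} (hc : IsIntegral ℤ_[p] c) {y : L}
    (hy : IsIntegral ℤ_[p] y) :
    ∃ z, IsIntegral ℤ_[p] z ∧ Algebra.norm K (1 + algebraMap K L c * y) =
      1 + p * c * z + c ^ p * Algebra.norm K y := by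
  have : CharZero K := charZero_of_injective_algebraMap (algebraMap ℚ_[p] K).injective
  exact exists_norm_one_add_eq (Fact.out : p.Prime).pos (finrank_eq_prime hξ hξgen hζ hζgen)
    (O p K).toSubring (fun k => isIntegral_inv_natCast)
    (fun j _ => exists_trace_eq_natCast_mul hξ hξgen hζ hζgen (hy.pow j)) hc

theorem IsIntegralUnit.norm {u : L} (hu : IsIntegralUnit p L u) :
    IsIntegralUnit p K (Algebra.norm K u) := by
  obtain ⟨u, rfl⟩ := hu
  have h : ((u : O p L) : L) * ((u⁻¹ : (O p L)ˣ) : O p L) = 1 :=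
    congrArg (Subtype.val : O p L → L) u.mul_inv
  have h' := congrArg (Algebra.norm K) h
  rw [map_mul, map_one] at h'
  exact ⟨.mkOfMulEqOne ⟨_, Algebra.isIntegral_norm K (u : O p L).2⟩
    ⟨_, Algebra.isIntegral_norm K ((u⁻¹ : (O p L)ˣ) : O p L).2⟩ (Subtype.ext h'), rfl⟩

theorem InU.norm [FiniteDimensional K L] (hξ : IsPrimitiveRoot ξ (p ^ (n + 1)))
    (hξgen : Algebra.adjoin ℚ_[p] {ξ} = ⊤) (hζ : IsPrimitiveRoot ζ (p ^ (n + 2)))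
    (hζgen : Algebra.adjoin ℚ_[p] {ζ} = ⊤) {q r : ℕ}
    (hr : r ≤ q + (p ^ (n + 1)).totient) (hr' : r ≤ p * q) {u : L} (hu : InU p L (p * q) u) :
    InU p K r (Algebra.norm K u) := by
  refine ⟨hu.1.norm, (valGE_iff hξ hξgen).2 ?_⟩
  obtain ⟨y, hy, hyu⟩ := (valGE_iff hζ hζgen).1 hu.2
  obtain ⟨t, ht, hπ⟩ := exists_one_sub_pow_eq_algebraMap_mul hξ hζ
  obtain ⟨v, hv, hpv⟩ := exists_natCast_eq_one_sub_pow_mul hξ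
  have hπi := isIntegral_one_sub hξ
  have hyi : IsIntegral ℤ_[p] (-(t ^ q * y)) := ((ht.pow q).mul hy).neg
  obtain ⟨z, hz, hnorm⟩ :=
    exists_norm_one_add_algebraMap_mul_eq hξ hξgen hζ hζgen (hπi.pow q) hyi
  have hu' : u = 1 + algebraMap K L ((1 - ξ) ^ q) * -(t ^ q * y) := by
    rw [pow_mul, hπ, mul_pow] at hyu
    rw [map_pow]
    linear_combination -hyu
  obtain ⟨a, ha⟩ := Nat.exists_eq_add_of_le hr
  obtain ⟨b, hb⟩ := Nat.exists_eq_add_of_le hr'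
  refine ⟨-((1 - ξ) ^ a * v * z + (1 - ξ) ^ b * Algebra.norm K (-(t ^ q * y))),
    ((((hπi.pow a).mul hv).mul hz).add
      ((hπi.pow b).mul (Algebra.isIntegral_norm K hyi))).neg, ?_⟩
  have h1 : (1 - ξ) ^ q * (1 - ξ) ^ (p ^ (n + 1)).totient = (1 - ξ) ^ r * (1 - ξ) ^ a := by
    rw [← pow_add, ha, pow_add]
  have h2 : ((1 - ξ) ^ q) ^ p = (1 - ξ) ^ r * (1 - ξ) ^ b := by
    rw [← pow_mul, mul_comm q p, hb, pow_add]
  rw [hu', hnorm, h2]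
  linear_combination -((1 - ξ) ^ q * z) * hpv - v * z * h1

end CyclotomicTower

end PadicStmt

open PadicStmt in
/-- For `2 ≤ i ≤ m`, with `K_i = ℚ_p(ζ_{p^i})` and
`r_i = (m-i+1)p^i - (m-i)p^{i-1}`, one has
`N_{K_i/K_{i-1}}(U_{r_i, K_i}) ⊆ U_{r_{i-1}, K_{i-1}}`. -/
theorem stmt11 (p : ℕ) [Fact p.Prime] (m i : ℕ) (hm : 2 ≤ m) (hi : 2 ≤ i) (him : i ≤ m)
    (Kim Ki : Type) [Field Kim] [Field Ki] [Algebra ℚ_[p] Kim] [Algebra ℚ_[p] Ki]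
    [Algebra Kim Ki] [IsScalarTower ℚ_[p] Kim Ki]
    [FiniteDimensional ℚ_[p] Kim] [FiniteDimensional ℚ_[p] Ki]
    (ζ : Ki) (hζ : IsPrimitiveRoot ζ (p ^ i)) (hgen : Algebra.adjoin ℚ_[p] {ζ} = ⊤)
    (ξ : Kim) (hξ : IsPrimitiveRoot ξ (p ^ (i - 1)))
    (hgen' : Algebra.adjoin ℚ_[p] {ξ} = ⊤)
    (u : Ki) (hu : InU p Ki ((m - i + 1) * p ^ i - (m - i) * p ^ (i - 1)) u) :
    InU p Kim ((m - (i - 1) + 1) * p ^ (i - 1) - (m - (i - 1)) * p ^ (i - 1 - 1))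
      (Algebra.norm Kim u) := by
  have hp : p.Prime := Fact.out
  have : FiniteDimensional Kim Ki := FiniteDimensional.right ℚ_[p] Kim Ki
  obtain ⟨n, rfl⟩ : ∃ n, i = n + 2 := ⟨i - 2, by omega⟩
  obtain ⟨d, rfl⟩ : ∃ d, m = n + 2 + d := ⟨m - (n + 2), by omega⟩
  obtain ⟨s, hs⟩ : ∃ s, p = s + 1 := ⟨p - 1, by have := hp.pos; omega⟩
  have e1 : n + 2 + d - (n + 2) = d := by omega
  have e2 : n + 2 + d - (n + 2 - 1) = d + 1 := by omega
  have e3 : n + 2 - 1 = n + 1 := by omega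
  have e4 : n + 1 - 1 = n := by omega
  have hq : (d + 1) * p ^ (n + 2) - d * p ^ (n + 1) =
      p * (p ^ n * ((d + 1) * s + 1)) := by
    rw [hs]
    apply Nat.sub_eq_of_eq_add
    ring
  have hr : (d + 1 + 1) * p ^ (n + 1) - (d + 1) * p ^ n = p ^ n * ((d + 2) * s + 1) := by
    rw [hs]
    apply Nat.sub_eq_of_eq_add
    ring
  rw [e1, e3, hq] at hu
  rw [e3] at hξ
  rw [e2, e3, e4, hr]
  refine InU.norm hξ hgen' hζ hgen ?_ ?_ hu
  · rw [Nat.totient_prime_pow_succ hp, hs, Nat.add_sub_cancel]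
    apply le_of_eq
    ring
  · rw [mul_left_comm]
    refine Nat.mul_le_mul_left _ ?_
    have hs1 : 1 ≤ s := by have := hp.two_le; omega
    rw [hs]
    nlinarith [Nat.zero_le (d * s), Nat.zero_le (d * s * (s - 1)),
      Nat.mul_le_mul_left s hs1, Nat.mul_le_mul_left (d * s) hs1]
end
end

section
/- Let p be an odd prime and m ≥ 1, and let K_1 = ℚ_p(ζ_p) be the p-th cyclotomic extension of ℚ_p, with r_1 = mp − (m−1). Then N_{K_1/ℚ_p}(U_{r_1, K_1}) ⊆ U_{m+1, ℚ_p}; that is, every unit u of K_1 with v_{K_1}(1−u) ≥ m(p−1)+1 satisfies N_{K_1/ℚ_p}(u) ≡ 1 (mod p^{m+1}). -/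
set_option synthInstance.maxHeartbeats 1000000
set_option maxHeartbeats 1000000
noncomputable section

namespace PadicStmt

section

variable {p : ℕ} [Fact p.Prime] {K : Type} [Field K] [Algebra ℚ_[p] K] [FiniteDimensional ℚ_[p] K]

omit [FiniteDimensional ℚ_[p] K] in
lemma norm_algHom_eq (σ τ : K →ₐ[ℚ_[p]] PadicAlgCl p) (y : K) : ‖σ y‖ = ‖τ y‖ := by
  rw [← PadicAlgCl.spectralNorm_eq, ← PadicAlgCl.spectralNorm_eq, spectralNorm, spectralNorm,
    minpoly.algHom_eq σ σ.injective, minpoly.algHom_eq τ τ.injective]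

lemma norm_algHom_pow_finrank (σ : K →ₐ[ℚ_[p]] PadicAlgCl p) (y : K) :
    ‖σ y‖ ^ Module.finrank ℚ_[p] K = ‖Algebra.norm ℚ_[p] y‖ := by
  rw [← PadicAlgCl.norm_extends]
  rw [Algebra.norm_eq_prod_embeddings ℚ_[p] (PadicAlgCl p) y, norm_prod,
    Finset.prod_congr rfl fun τ _ => norm_algHom_eq τ σ y, Finset.prod_const, Finset.card_univ,
    AlgHom.card]

omit [FiniteDimensional ℚ_[p] K] in
lemma norm_norm_le_one {y : K} (hy : IsIntegral ℤ_[p] y) : ‖Algebra.norm ℚ_[p] y‖ ≤ 1 := by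
  have h : IsIntegral ℤ_[p] (Algebra.norm ℚ_[p] y) := Algebra.isIntegral_norm ℚ_[p] hy
  obtain ⟨z, hz⟩ := IsIntegrallyClosed.isIntegral_iff.mp h
  rw [← hz]
  exact z.2

lemma isIntegral_inv_of_norm_eq_one {y : K} (hy : IsIntegral ℤ_[p] y)
    (h1 : ‖Algebra.norm ℚ_[p] y‖ = 1) : IsIntegral ℤ_[p] y⁻¹ := by
  classical
  let σ : K →ₐ[ℚ_[p]] PadicAlgCl p := IsAlgClosed.lift
  have hint (τ : K →ₐ[ℚ_[p]] PadicAlgCl p) : IsIntegral ℤ_[p] (τ y) :=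
    hy.map (τ.restrictScalars ℤ_[p])
  have hN := Algebra.norm_eq_prod_embeddings ℚ_[p] (PadicAlgCl p) y
  have hN0 : Algebra.norm ℚ_[p] y ≠ 0 := by
    intro h
    simp [h] at h1
  have hy0 : σ y ≠ 0 := by
    intro h
    rw [map_eq_zero] at h
    exact hN0 (h ▸ Algebra.norm_zero)
  rw [← isIntegral_algHom_iff (σ.restrictScalars ℤ_[p]) σ.injective]
  change IsIntegral ℤ_[p] (σ y⁻¹)
  let w : ℤ_[p] := ⟨(Algebra.norm ℚ_[p] y)⁻¹, by simp [h1]⟩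
  have hw : σ y⁻¹ = algebraMap ℤ_[p] (PadicAlgCl p) w * ∏ τ ∈ Finset.univ.erase σ, τ y := by
    rw [← Finset.mul_prod_erase _ _ (Finset.mem_univ σ)] at hN
    have hw' : algebraMap ℤ_[p] (PadicAlgCl p) w =
        (algebraMap ℚ_[p] (PadicAlgCl p) (Algebra.norm ℚ_[p] y))⁻¹ := by
      rw [← map_inv₀]
      rfl
    have hP : ∏ τ ∈ Finset.univ.erase σ, τ y ≠ 0 := by
      intro h
      rw [h, mul_zero] at hN
      exact hN0 (by simpa using hN)
    rw [hw', hN, map_inv₀]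
    field_simp
  rw [hw]
  exact isIntegral_algebraMap.mul (IsIntegral.prod _ fun τ _ => hint τ)

lemma norm_norm_le_inv_of_mem_maxIdeal {y : O p K} (hy : y ∈ maxIdeal p K) :
    ‖Algebra.norm ℚ_[p] (y : K)‖ ≤ (p : ℝ)⁻¹ := by
  have h1 : ‖Algebra.norm ℚ_[p] (y : K)‖ < 1 := by
    refine lt_of_le_of_ne (norm_norm_le_one y.2) fun h => ?_
    have hy0 : (y : K) ≠ 0 := by
      rintro h0
      simp [h0] at h
    have hu : IsUnit y := IsUnit.of_mul_eq_one
      (⟨(y : K)⁻¹, isIntegral_inv_of_norm_eq_one y.2 h⟩ : O p K)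
      (Subtype.ext (mul_inv_cancel₀ hy0))
    have htop : (⊥ : Ideal (O p K)).jacobson = ⊤ := Ideal.eq_top_of_isUnit_mem _ hy hu
    exact bot_ne_top (Ideal.jacobson_eq_top_iff.mp htop)
  have := (Padic.norm_lt_pow_iff_norm_le_pow_sub_one (Algebra.norm ℚ_[p] (y : K)) 0).mp
    (by simpa using h1)
  simpa using this

lemma norm_algHom_le_pow_of_mem_maxIdeal_pow (σ : K →ₐ[ℚ_[p]] PadicAlgCl p) {c : ℝ} (hc : 0 ≤ c)
    (hcd : c ^ Module.finrank ℚ_[p] K = (p : ℝ)⁻¹) (n : ℕ) {y : O p K}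
    (hy : y ∈ maxIdeal p K ^ n) : ‖σ y‖ ≤ c ^ n := by
  have hd : Module.finrank ℚ_[p] K ≠ 0 := Module.finrank_pos.ne'
  induction n generalizing y with
  | zero =>
    rw [pow_zero, ← pow_le_one_iff_of_nonneg (norm_nonneg _) hd, norm_algHom_pow_finrank]
    exact norm_norm_le_one y.2
  | succ n ih =>
    rw [pow_succ] at hy
    refine Submodule.mul_induction_on hy (fun a ha b hb => ?_) fun a b ha hb => ?_
    · have hb' : ‖σ b‖ ≤ c := by
        rw [← pow_le_pow_iff_left₀ (norm_nonneg _) hc hd, norm_algHom_pow_finrank, hcd]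
        exact norm_norm_le_inv_of_mem_maxIdeal hb
      rw [Subalgebra.coe_mul, map_mul, norm_mul, pow_succ]
      exact mul_le_mul (ih ha) hb' (norm_nonneg _) (pow_nonneg hc n)
    · rw [Subalgebra.coe_add, map_add]
      exact (PadicAlgCl.isNonarchimedean p _ _).trans (max_le ha hb)

end

lemma norm_prod_sub_one_le {ι F : Type*} [NormedField F] (hF : IsNonarchimedean (norm : F → ℝ))
    (s : Finset ι) (f : ι → F) {ε : ℝ} (h0 : 0 ≤ ε) (hf1 : ∀ i ∈ s, ‖f i‖ ≤ 1)
    (hf : ∀ i ∈ s, ‖f i - 1‖ ≤ ε) : ‖∏ i ∈ s, f i - 1‖ ≤ ε := by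
  classical
  induction s using Finset.induction_on with
  | empty => simpa using h0
  | insert a s ha ih =>
    rw [Finset.prod_insert ha, show f a * ∏ i ∈ s, f i - 1 =
      f a * (∏ i ∈ s, f i - 1) + (f a - 1) by ring]
    refine (hF _ _).trans (max_le ?_ (hf a (Finset.mem_insert_self a s)))
    rw [norm_mul]
    exact (mul_le_of_le_one_left (norm_nonneg _) (hf1 a (Finset.mem_insert_self a s))).trans
      (ih (fun i hi => hf1 i (Finset.mem_insert_of_mem hi))
        fun i hi => hf i (Finset.mem_insert_of_mem hi))

lemma finrank_le_of_adjoin_primitiveRoot_eq_top {p : ℕ} [Fact p.Prime] {F K : Type*} [Field F]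
    [Field K] [Algebra F K] [FiniteDimensional F K] {ζ : K} (hζ : IsPrimitiveRoot ζ p)
    (hgen : Algebra.adjoin F {ζ} = ⊤) : Module.finrank F K ≤ p - 1 := by
  have hp : p.Prime := Fact.out
  have hint : IsIntegral F ζ := Algebra.IsIntegral.isIntegral ζ
  have hroot : Polynomial.aeval ζ (Polynomial.cyclotomic p F) = 0 := by
    rw [Polynomial.aeval_def, Polynomial.eval₂_eq_eval_map, Polynomial.map_cyclotomic]
    exact hζ.isRoot_cyclotomic hp.pos
  have hle := Polynomial.natDegree_le_of_dvd (minpoly.dvd F ζ hroot)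
    (Polynomial.cyclotomic_ne_zero p F)
  rw [Polynomial.natDegree_cyclotomic, Nat.totient_prime hp] at hle
  rwa [(PowerBasis.ofAdjoinEqTop hint hgen).finrank, PowerBasis.ofAdjoinEqTop_dim]

end PadicStmt

open PadicStmt in
/-- Let `p` be an odd prime, `m ≥ 1`, and `K_1 = ℚ_p(ζ_p)`, with
`r_1 = mp - (m-1) = m(p-1)+1`.  Then every unit `u` of `K_1` with `v_{K_1}(1-u) ≥ r_1`
satisfies `N_{K_1/ℚ_p}(u) ≡ 1 (mod p^{m+1})`. -/
theorem stmt12 (p : ℕ) [Fact p.Prime] (hp : Odd p) (m : ℕ) (hm : 1 ≤ m)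
    (K₁ : Type) [Field K₁] [Algebra ℚ_[p] K₁] [FiniteDimensional ℚ_[p] K₁]
    (ζ : K₁) (hζ : IsPrimitiveRoot ζ p) (hgen : Algebra.adjoin ℚ_[p] {ζ} = ⊤)
    (u : K₁) (hu : InU p K₁ (m * p - (m - 1)) u) :
    ‖Algebra.norm ℚ_[p] u - 1‖ ≤ (p : ℝ) ^ (-((m : ℤ) + 1)) := by
  have hpp : p.Prime := Fact.out
  have hp0 : (0 : ℝ) < p := Nat.cast_pos.mpr hpp.pos
  have hp1 : (1 : ℝ) < p := Nat.one_lt_cast.mpr hpp.one_lt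
  set d := Module.finrank ℚ_[p] K₁ with hd
  have hd0 : d ≠ 0 := Module.finrank_pos.ne'
  have hdp : d ≤ p - 1 := finrank_le_of_adjoin_primitiveRoot_eq_top hζ hgen
  obtain ⟨⟨v, hv⟩, x, hxu, hx⟩ := hu
  set r := m * p - (m - 1) with hr
  have hrd : m * d < r := by
    have h1 : m * d ≤ m * (p - 1) := Nat.mul_le_mul_left m hdp
    have h2 : m * (p - 1) + m = m * p := by
      rw [← Nat.mul_succ, Nat.succ_eq_add_one, Nat.sub_add_cancel hpp.one_le]
    omega
  set c : ℝ := ((p : ℝ)⁻¹) ^ ((d : ℝ)⁻¹) with hc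
  have hc0 : 0 ≤ c := by positivity
  have hcd : c ^ d = (p : ℝ)⁻¹ := Real.rpow_inv_natCast_pow (by positivity) hd0
  have hz : ‖Algebra.norm ℚ_[p] u - 1‖ ≤ c ^ r := by
    have hN := Algebra.norm_eq_prod_embeddings ℚ_[p] (PadicAlgCl p) u
    have hcoe : ‖Algebra.norm ℚ_[p] u - 1‖ =
        ‖∏ σ : K₁ →ₐ[ℚ_[p]] PadicAlgCl p, σ u - 1‖ := by
      rw [← hN, ← PadicAlgCl.norm_extends]
      rw [map_sub, map_one]
    rw [hcoe]
    refine norm_prod_sub_one_le (PadicAlgCl.isNonarchimedean p) _ _ (pow_nonneg hc0 r)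
      (fun σ _ => ?_) fun σ _ => ?_
    · have := norm_algHom_le_pow_of_mem_maxIdeal_pow σ hc0 hcd 0 (y := (v : O p K₁)) (by simp)
      simpa [hv] using this
    · have := norm_algHom_le_pow_of_mem_maxIdeal_pow σ hc0 hcd r hx
      rwa [hxu, map_sub, map_one, norm_sub_rev] at this
  have hlt : ‖Algebra.norm ℚ_[p] u - 1‖ < (p : ℝ) ^ (-(m : ℤ)) := by
    refine lt_of_pow_lt_pow_left₀ d (by positivity) ?_
    calc ‖Algebra.norm ℚ_[p] u - 1‖ ^ d ≤ (c ^ r) ^ d := pow_le_pow_left₀ (norm_nonneg _) hz d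
      _ = ((p : ℝ)⁻¹) ^ r := by rw [← pow_mul, mul_comm, pow_mul, hcd]
      _ < ((p : ℝ)⁻¹) ^ (m * d) :=
        pow_lt_pow_right_of_lt_one₀ (inv_pos.mpr hp0) (inv_lt_one_of_one_lt₀ hp1) hrd
      _ = ((p : ℝ) ^ (-(m : ℤ))) ^ d := by rw [pow_mul, zpow_neg, zpow_natCast, inv_pow]
  rw [Padic.norm_lt_pow_iff_norm_le_pow_sub_one] at hlt
  rwa [neg_add]
end
end

section
/- Let K = ℚ_3(ζ_{3^4}) be the 81-st cyclotomic extension of ℚ_3, and let α ∈ ℤ_3^× be a unit of ℚ_3 with v_3(α − 1) = 2 (i.e., α ≡ 1 mod 9 but α ≢ 1 mod 27). Then α, viewed as a unit of K, is a 3-primary unit of K, and N_{K/ℚ_3}(α) = α^{54} ≢ 1 (mod 3^6). In particular, the congruence N_{K/ℚ_3}(α) ≡ 1 (mod 3^{m+1}) for a p-primary unit with m = 4 cannot in general be improved to modulus 3^{m+2}. -/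
set_option synthInstance.maxHeartbeats 1000000
set_option maxHeartbeats 1000000
noncomputable section

open Polynomial in
/-- The prime power cyclotomic polynomials are irreducible over `ℚ_[p]`. -/
theorem Padic.irreducible_cyclotomic_prime_pow (p : ℕ) [Fact p.Prime] (n : ℕ) :
    Irreducible (cyclotomic (p ^ (n + 1)) ℚ_[p]) := by
  have hE := cyclotomic_prime_pow_comp_X_add_one_isEisensteinAt p n
  set f := (cyclotomic (p ^ (n + 1)) ℤ).comp (X + 1) with hf
  have hfm : f.Monic := by
    have := (cyclotomic.monic (p ^ (n + 1)) ℤ).comp_X_add_C 1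
    simpa [hf] using this
  set g := f.map (Int.castRingHom ℤ_[p]) with hg
  have hgm : g.Monic := hfm.map _
  have hgdeg : g.natDegree = f.natDegree := hfm.natDegree_map _
  have hfdeg : f.natDegree = (p ^ (n + 1)).totient := by
    rw [hf, natDegree_comp, natDegree_cyclotomic, show (X + 1 : ℤ[X]) = X + C 1 by simp,
      natDegree_X_add_C, mul_one]
  have hprime : (Ideal.span {(p : ℤ_[p])}).IsPrime := by
    rw [← PadicInt.maximalIdeal_eq_span_p]
    infer_instance
  have hgE : g.IsEisensteinAt (Ideal.span {(p : ℤ_[p])}) := by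
    refine hgm.isEisensteinAt_of_mem_of_notMem hprime.ne_top (fun {i} hi => ?_) ?_
    · have := hE.mem (hgdeg ▸ hi)
      rw [Ideal.submodule_span_eq, Ideal.mem_span_singleton] at this
      rw [Ideal.mem_span_singleton, hg, coeff_map]
      simpa using map_dvd (Int.castRingHom ℤ_[p]) this
    · have := hE.notMem
      rw [Ideal.submodule_span_eq, Ideal.span_singleton_pow, Ideal.mem_span_singleton] at this
      rw [Ideal.span_singleton_pow, Ideal.mem_span_singleton, hg, coeff_map]
      intro h
      apply this
      rw [eq_intCast, ← Ideal.mem_span_singleton, ← PadicInt.norm_le_pow_iff_mem_span_pow,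
        PadicInt.norm_int_le_pow_iff_dvd] at h
      exact_mod_cast h
  have hgirr : Irreducible g := hgE.irreducible hprime hgm.isPrimitive <| by
    rw [hgdeg, hfdeg]
    exact Nat.totient_pos.2 (pow_pos (Fact.out : p.Prime).pos _)
  rw [hgm.irreducible_iff_irreducible_map_fraction_map (K := ℚ_[p])] at hgirr
  have hcomp : g.map (algebraMap ℤ_[p] ℚ_[p])
      = algEquivAevalXAddC (1 : ℚ_[p]) (cyclotomic (p ^ (n + 1)) ℚ_[p]) := by
    rw [hg, hf, Polynomial.map_map, map_comp, map_cyclotomic]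
    simp [algEquivAevalXAddC_apply, comp, aeval_def, eval₂_eq_eval_map]
  rw [hcomp] at hgirr
  exact (MulEquiv.irreducible_iff _).1 hgirr

/-- Every `1 + 9 u` with `u` a `3`-adic integer is a cube in `ℤ_[3]`. -/
theorem PadicInt.exists_cube_eq_one_add_nine_mul (u : ℤ_[3]) :
    ∃ b : ℤ_[3], b ^ 3 = 1 + 9 * u := by
  have h3 : ‖(3 : ℤ_[3])‖ = 3⁻¹ := by simpa using PadicInt.norm_p (p := 3)
  have h6 : ‖6 * u + 9 * u ^ 2‖ < 1 := by
    rw [show 6 * u + 9 * u ^ 2 = 3 * (2 * u + 3 * u ^ 2) by ring, norm_mul, h3]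
    have := PadicInt.norm_le_one (2 * u + 3 * u ^ 2)
    linarith
  have hder : ‖1 + (6 * u + 9 * u ^ 2)‖ = 1 := by
    rw [PadicInt.norm_add_eq_max_of_ne (by rw [norm_one]; exact h6.ne'), norm_one,
      max_eq_left h6.le]
  have hval : ‖3 * u ^ 2 + 3 * u ^ 3‖ < 1 := by
    rw [show 3 * u ^ 2 + 3 * u ^ 3 = 3 * (u ^ 2 + u ^ 3) by ring, norm_mul, h3]
    have := PadicInt.norm_le_one (u ^ 2 + u ^ 3)
    linarith
  let F : Polynomial ℤ_[3] :=
    .X + .C 3 * .X ^ 2 + .C 3 * .X ^ 3 - .C u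
  have hF (x : ℤ_[3]) : F.aeval x = x + 3 * x ^ 2 + 3 * x ^ 3 - u := by simp [F]
  have hF' (x : ℤ_[3]) : F.derivative.aeval x = 1 + (6 * x + 9 * x ^ 2) := by
    simp [F]
    ring
  obtain ⟨z, hz, -⟩ := hensels_lemma (F := F) (a := u) <| by
    rw [hF, hF', hder, show u + 3 * u ^ 2 + 3 * u ^ 3 - u = 3 * u ^ 2 + 3 * u ^ 3 by ring]
    simpa using hval
  rw [hF] at hz
  exact ⟨1 + 3 * z, by linear_combination 9 * hz⟩

/-- Cubing a principal unit of `ℚ_[3]` divides its distance to `1` by `3`. -/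
theorem Padic.norm_cube_sub_one {x : ℚ_[3]} (hx : ‖x - 1‖ ≤ 3⁻¹) :
    ‖x ^ 3 - 1‖ = ‖x - 1‖ * 3⁻¹ := by
  have h3 : ‖(3 : ℚ_[3])‖ = 3⁻¹ := by simpa using Padic.norm_p (p := 3)
  have hlt : ‖(x - 1) * (3 + (x - 1))‖ < 3⁻¹ := by
    have hle : ‖3 + (x - 1)‖ ≤ 3⁻¹ :=
      (Padic.nonarchimedean _ _).trans (max_le h3.le hx)
    rw [norm_mul]
    nlinarith [norm_nonneg (x - 1), norm_nonneg (3 + (x - 1))]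
  rw [show x ^ 3 - 1 = (x - 1) * (3 + (x - 1) * (3 + (x - 1))) by ring, norm_mul,
    Padic.add_eq_max_of_ne (by rw [h3]; exact hlt.ne'), h3, max_eq_left hlt.le]

theorem Padic.norm_sq_sub_one {x : ℚ_[3]} (hx : ‖x - 1‖ < 1) : ‖x ^ 2 - 1‖ = ‖x - 1‖ := by
  have h2 : ‖(2 : ℚ_[3])‖ = 1 := by
    simpa using (Padic.norm_natCast_eq_one_iff (p := 3) (n := 2)).2 (by decide)
  rw [show x ^ 2 - 1 = (x - 1) * (2 + (x - 1)) by ring, norm_mul,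
    Padic.add_eq_max_of_ne (by rw [h2]; exact hx.ne'), h2, max_eq_left hx.le, mul_one]

namespace PadicStmt

variable (p : ℕ) [Fact p.Prime] (K : Type) [Field K] [Algebra ℚ_[p] K]

theorem isUnramifiedExt_self : IsUnramifiedExt p K K := by
  have : intMap p K K = RingHom.id _ := RingHom.ext fun _ => rfl
  rw [IsUnramifiedExt, this, Ideal.map_id]

theorem isIntegralUnit_algebraMap (u : ℤ_[p]ˣ) :
    IsIntegralUnit p K (algebraMap ℚ_[p] K (u : ℤ_[p])) :=
  ⟨u.map (algebraMap ℤ_[p] (O p K)), rfl⟩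

variable {p K} in
/-- An integral unit that is already a `p`-th power in `K` is `p`-primary. -/
theorem IsIntegralUnit.isPPrimary [FiniteDimensional ℚ_[p] K] {α β : K}
    (hα : IsIntegralUnit p K α) (hβ : β ^ p = α) : IsPPrimary p K α :=
  ⟨hα, ⟨{ L := K, β := β, pow_eq := hβ, unram := isUnramifiedExt_self p K }⟩⟩

end PadicStmt

open PadicStmt in
/-- Let `K = ℚ_3(ζ_{3^4})` and let `α` be a unit of `ℚ_3` with
`v_3(α - 1) = 2`.  Then `α`, viewed in `K`, is a `3`-primary unit of `K`, its norm is
`α^54`, and `N_{K/ℚ_3}(α) = α^54 ≢ 1 (mod 3^6)`. -/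
theorem stmt14 (K : Type) [Field K] [Algebra ℚ_[3] K] [FiniteDimensional ℚ_[3] K]
    (ζ : K) (hζ : IsPrimitiveRoot ζ (3 ^ 4)) (hgen : Algebra.adjoin ℚ_[3] {ζ} = ⊤)
    (α : ℚ_[3]) (hα : ‖α - 1‖ = (3 : ℝ) ^ (-2 : ℤ)) :
    IsPPrimary 3 K (algebraMap ℚ_[3] K α) ∧
    Algebra.norm ℚ_[3] (algebraMap ℚ_[3] K α) = α ^ 54 ∧
    ¬ ‖α ^ 54 - 1‖ ≤ (3 : ℝ) ^ (-6 : ℤ) := by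
  have h9 : ‖(9 : ℚ_[3])‖ = 9⁻¹ := by
    have h3 : ‖(3 : ℚ_[3])‖ = 3⁻¹ := by simpa using Padic.norm_p (p := 3)
    rw [show (9 : ℚ_[3]) = 3 * 3 by norm_num, norm_mul, h3]
    norm_num
  have hα' : ‖α - 1‖ = 9⁻¹ := by
    rw [hα]
    norm_num
  refine ⟨?_, ?_, ?_⟩
  · have hu : ‖(α - 1) / 9‖ ≤ 1 := by
      rw [norm_div, hα', h9, div_self (by norm_num)]
    obtain ⟨u, hu'⟩ : ∃ u : ℤ_[3], (u : ℚ_[3]) = (α - 1) / 9 := ⟨⟨_, hu⟩, rfl⟩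
    obtain ⟨b, hb⟩ := PadicInt.exists_cube_eq_one_add_nine_mul u
    have hbα : (b : ℚ_[3]) ^ 3 = α := by
      have h := congrArg (algebraMap ℤ_[3] ℚ_[3]) hb
      simp only [map_pow, map_add, map_one, map_mul, map_ofNat, PadicInt.algebraMap_apply] at h
      rw [h, hu']
      ring
    have hα1 : ‖α‖ = 1 := by
      rw [show α = 1 + (α - 1) by ring, Padic.add_eq_max_of_ne (by rw [hα']; norm_num), hα']
      norm_num
    have hunit := isIntegralUnit_algebraMap 3 K (PadicInt.mkUnits hα1)
    rw [PadicInt.mkUnits_eq] at hunit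
    exact hunit.isPPrimary (β := algebraMap ℚ_[3] K b) (by rw [← map_pow, hbα])
  · have : IsCyclotomicExtension {3 ^ 4} ℚ_[3] K := by
      rw [IsCyclotomicExtension.iff_adjoin_eq_top]
      refine ⟨fun n hn _ => ⟨ζ, by rwa [Set.mem_singleton_iff.1 hn]⟩, ?_⟩
      refine top_unique (hgen ▸ Algebra.adjoin_mono ?_)
      rintro _ rfl
      exact ⟨3 ^ 4, rfl, by norm_num, hζ.pow_eq_one⟩
    rw [Algebra.norm_algebraMap, IsCyclotomicExtension.finrank (n := 3 ^ 4) K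
      (Padic.irreducible_cyclotomic_prime_pow 3 3), Nat.totient_prime_pow Nat.prime_three (by simp)]
    norm_num
  · have h1 : ‖α ^ 3 - 1‖ = 27⁻¹ := by
      rw [Padic.norm_cube_sub_one (by rw [hα']; norm_num), hα']
      norm_num
    have h2 : ‖(α ^ 3) ^ 3 - 1‖ = 81⁻¹ := by
      rw [Padic.norm_cube_sub_one (by rw [h1]; norm_num), h1]
      norm_num
    have h3 : ‖((α ^ 3) ^ 3) ^ 3 - 1‖ = 243⁻¹ := by
      rw [Padic.norm_cube_sub_one (by rw [h2]; norm_num), h2]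
      norm_num
    rw [show α ^ 54 = (((α ^ 3) ^ 3) ^ 3) ^ 2 by ring,
      Padic.norm_sq_sub_one (by rw [h3]; norm_num), h3]
    norm_num
end
end

section
/- Let p be a prime and m ≥ 1, and let K = ℚ_p(ζ_{p^m}) be the p^m-th cyclotomic extension of ℚ_p. Then N_{K/ℚ_p}(U_{p^m−1, K}) is not contained in U_{m+1, ℚ_p}; that is, there exists a unit u ∈ O_K^× with v_K(1−u) ≥ p^m − 1 such that N_{K/ℚ_p}(u) ≢ 1 (mod p^{m+1}). -/
set_option synthInstance.maxHeartbeats 1000000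
set_option maxHeartbeats 1000000
noncomputable section

/-- Second-order binomial expansion with explicit cubic remainder. -/
theorem exists_one_add_pow_eq {R : Type*} [CommRing R] (t : R) (n : ℕ) :
    ∃ r, (1 + t) ^ n = 1 + n * t + n.choose 2 * t ^ 2 + t ^ 3 * r := by
  induction n with
  | zero => exact ⟨0, by simp⟩
  | succ n ih =>
    obtain ⟨r, hr⟩ := ih
    refine ⟨n.choose 2 + r * (1 + t), ?_⟩
    rw [pow_succ, hr, Nat.choose_succ_succ' n 1, Nat.choose_one_right]
    push_cast
    ring

theorem exists_one_add_prime_mul_pow_eq {R : Type*} [CommRing R] {p : ℕ} (hp : p.Prime) (x : R)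
    (hx : p = 2 → (2 : R) ∣ x) (k : ℕ) :
    ∃ r, (1 + p * x) ^ p ^ k = 1 + (p : R) ^ (k + 1) * x * (1 + p * r) := by
  induction k with
  | zero => exact ⟨0, by simp⟩
  | succ k ih =>
    obtain ⟨r, hr⟩ := ih
    rw [pow_succ, pow_mul, hr]
    rcases hp.eq_two_or_odd' with rfl | hodd
    · obtain ⟨s, rfl⟩ := hx rfl
      refine ⟨r + 2 ^ k * s * (1 + 2 * r) ^ 2, ?_⟩
      push_cast
      ring
    · have h3 : 3 ≤ p := by
        have := hp.two_le
        obtain ⟨j, rfl⟩ := hodd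
        omega
      obtain ⟨q, hq⟩ : p ∣ p.choose 2 := hp.dvd_choose_self two_ne_zero (by omega)
      obtain ⟨s, hs⟩ := exists_one_add_pow_eq ((p : R) ^ (k + 1) * x * (1 + p * r)) p
      refine ⟨r + p ^ k * x * q * (1 + p * r) ^ 2 + p ^ (2 * k) * x ^ 2 * (1 + p * r) ^ 3 * s, ?_⟩
      rw [hs, hq]
      push_cast
      ring

open Polynomial in
/-- The norm of `1 + p (1 + η + ⋯ + η ^ (p ^ k - 1))` from the `p ^ (k + 1)`-th to the `p`-th
cyclotomic level. -/
theorem IsPrimitiveRoot.exists_prod_filter_one_add_geom_sum {R : Type*} [CommRing R] [IsDomain R]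
    [DecidableEq R] {p k : ℕ} (hp : p.Prime) {z : R} (hz : IsPrimitiveRoot z (p ^ (k + 1))) :
    ∃ r, ∏ η ∈ primitiveRoots (p ^ (k + 1)) R with η ^ p ^ k = z ^ p ^ k,
      (1 + (p : R) * ∑ i ∈ Finset.range (p ^ k), η ^ i) = 1 + (p : R) ^ (k + 1) * (1 + p * r) := by
  have hq : 0 < p ^ k := pow_pos hp.pos k
  have hq' : 0 < p ^ (k + 1) := pow_pos hp.pos _
  have hω : IsPrimitiveRoot (z ^ p ^ k) p := hz.pow hq' (pow_succ p k)
  have hξ : IsPrimitiveRoot (z ^ p) (p ^ k) := hz.pow hq' (pow_succ' p k)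
  have hz0 : z ≠ 0 := hz.ne_zero hq'.ne'
  have hω1 : 1 - z ^ p ^ k ≠ 0 := sub_ne_zero.2 (hω.ne_one hp.one_lt).symm
  have hmem (η : R) (hη : η ^ p ^ k = z ^ p ^ k) : η ∈ primitiveRoots (p ^ (k + 1)) R := by
    rw [mem_primitiveRoots hq']
    have h1 : η ^ p ^ (k + 1) = 1 := by rw [pow_succ, pow_mul, hη, ← pow_mul, ← pow_succ, hz.1]
    have : Fact p.Prime := ⟨hp⟩
    have := orderOf_eq_prime_pow (x := η) (p := p) (n := k) (by
      rw [hη]; exact hω.ne_one hp.one_lt) h1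
    exact this ▸ IsPrimitiveRoot.orderOf η
  have hset : {η ∈ primitiveRoots (p ^ (k + 1)) R | η ^ p ^ k = z ^ p ^ k} =
      (nthRootsFinset (p ^ k) (1 : R)).image (· * z) := by
    ext η
    simp only [Finset.mem_filter, Finset.mem_image, Polynomial.mem_nthRootsFinset hq]
    constructor
    · rintro ⟨-, h⟩
      have h1 : (z ^ (p ^ (k + 1) - 1)) * z = 1 := by
        rw [← pow_succ, Nat.sub_add_cancel hq', hz.1]
      refine ⟨η * z ^ (p ^ (k + 1) - 1), ?_, by rw [mul_assoc, h1, mul_one]⟩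
      rw [mul_pow, h, ← mul_pow, mul_comm, h1, one_pow]
    · rintro ⟨ξ, h, rfl⟩
      have : (ξ * z) ^ p ^ k = z ^ p ^ k := by rw [mul_pow, h, one_mul]
      exact ⟨hmem _ this, this⟩
  have hprod (c : R) : ∏ η ∈ primitiveRoots (p ^ (k + 1)) R with η ^ p ^ k = z ^ p ^ k, (c - η) =
      c ^ p ^ k - z ^ p ^ k := by
    rw [hset, Finset.prod_image (fun _ _ _ _ h ↦ mul_right_cancel₀ hz0 h),
      hξ.pow_sub_pow_eq_prod_sub_mul _ _ hq]
  obtain ⟨r, hr⟩ := exists_one_add_prime_mul_pow_eq hp (1 - z ^ p ^ k) (by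
    rintro rfl
    rw [hω.eq_neg_one_of_two_right]
    norm_num) k
  refine ⟨r, mul_right_cancel₀ hω1 ?_⟩
  have h1 := hprod 1
  rw [one_pow] at h1
  rw [← h1, ← Finset.prod_mul_distrib, h1]
  calc _ = ∏ η ∈ primitiveRoots (p ^ (k + 1)) R with η ^ p ^ k = z ^ p ^ k,
        (1 + p * (1 - z ^ p ^ k) - η) := Finset.prod_congr rfl fun η hη ↦ by
          rw [← (Finset.mem_filter.1 hη).2, ← mul_neg_geom_sum η]
          ring
    _ = _ := by rw [hprod, hr]; ring

theorem IsPrimitiveRoot.exists_prod_one_add_geom_sum {R : Type*} [CommRing R] [IsDomain R]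
    {p k : ℕ} (hp : p.Prime) {z : R} (hz : IsPrimitiveRoot z (p ^ (k + 1))) :
    ∃ r, ∏ η ∈ primitiveRoots (p ^ (k + 1)) R,
      (1 + (p : R) * ∑ i ∈ Finset.range (p ^ k), η ^ i) = 1 + (p : R) ^ (k + 1) * (p * r - 1) := by
  classical
  have : NeZero p := ⟨hp.ne_zero⟩
  have hq' : 0 < p ^ (k + 1) := pow_pos hp.pos _
  have hω : IsPrimitiveRoot (z ^ p ^ k) p := hz.pow hq' (pow_succ p k)
  have hmaps : ∀ η ∈ primitiveRoots (p ^ (k + 1)) R, η ^ p ^ k ∈ primitiveRoots p R := by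
    intro η hη
    rw [mem_primitiveRoots hp.pos]
    exact ((mem_primitiveRoots hq').1 hη).pow hq' (pow_succ p k)
  have hfib : ∀ ω ∈ primitiveRoots p R, ∃ r,
      ∏ η ∈ primitiveRoots (p ^ (k + 1)) R with η ^ p ^ k = ω,
      (1 + (p : R) * ∑ i ∈ Finset.range (p ^ k), η ^ i) = 1 + (p : R) ^ (k + 1) * (1 + p * r) := by
    intro ω h
    obtain ⟨i, -, hi, rfl⟩ :=
      hω.isPrimitiveRoot_iff.1 ((mem_primitiveRoots hp.pos).1 h)
    have := (hz.pow_of_coprime i (hi.pow_right _)).exists_prod_filter_one_add_geom_sum hp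
    rwa [pow_right_comm] at this
  have hmul : ∀ s ⊆ primitiveRoots p R, ∃ r, ∏ ω ∈ s,
      ∏ η ∈ primitiveRoots (p ^ (k + 1)) R with η ^ p ^ k = ω,
      (1 + (p : R) * ∑ i ∈ Finset.range (p ^ k), η ^ i) =
        1 + (p : R) ^ (k + 1) * (s.card + p * r) := by
    intro s
    induction s using Finset.induction with
    | empty => exact fun _ ↦ ⟨0, by simp⟩
    | insert ω s hωs ih =>
      intro hs
      rw [Finset.insert_subset_iff] at hs
      obtain ⟨r, hr⟩ := ih hs.2
      obtain ⟨t, ht⟩ := hfib ω hs.1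
      refine ⟨r + t + p ^ k * (1 + p * t) * (s.card + p * r), ?_⟩
      rw [Finset.prod_insert hωs, hr, ht, Finset.card_insert_of_notMem hωs]
      push_cast
      ring
  obtain ⟨r, hr⟩ := hmul _ subset_rfl
  refine ⟨r + 1, ?_⟩
  rw [← Finset.prod_fiberwise_of_maps_to hmaps, hr, hω.card_primitiveRoots,
    Nat.totient_prime hp, Nat.cast_sub hp.one_le]
  push_cast
  ring

open Polynomial in
theorem irreducible_cyclotomic_prime_pow_padic (p : ℕ) [hp : Fact p.Prime] (k : ℕ) :
    Irreducible (cyclotomic (p ^ (k + 1)) ℚ_[p]) := by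
  have hpp : Prime (p : ℤ_[p]) := PadicInt.prime_p
  have hX : (X + 1 : ℤ_[p][X]) = X + C 1 := by simp
  have hmonic : ((cyclotomic (p ^ (k + 1)) ℤ_[p]).comp (X + 1)).Monic := by
    rw [hX]
    exact (cyclotomic.monic _ _).comp_X_add_C 1
  have hmap : (cyclotomic (p ^ (k + 1)) ℤ_[p]).comp (X + 1) =
      ((cyclotomic (p ^ (k + 1)) ℤ).comp (X + 1)).map (Int.castRingHom ℤ_[p]) := by
    simp [map_comp]
  have hei : ((cyclotomic (p ^ (k + 1)) ℤ_[p]).comp (X + 1)).IsEisensteinAt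
      (Ideal.span {(p : ℤ_[p])}) := by
    refine hmonic.isEisensteinAt_of_mem_of_notMem
      ((Ideal.span_singleton_prime hpp.ne_zero).2 hpp).ne_top ?_ ?_
    · intro i hi
      have hmz : ((cyclotomic (p ^ (k + 1)) ℤ).comp (X + 1)).Monic := by
        rw [show (X + 1 : ℤ[X]) = X + C 1 by simp]
        exact (cyclotomic.monic _ _).comp_X_add_C 1
      rw [hmap, hmz.natDegree_map] at hi
      have := (cyclotomic_prime_pow_comp_X_add_one_isEisensteinAt p k).mem hi
      rw [hmap, coeff_map, Ideal.mem_span_singleton]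
      obtain ⟨c, hc⟩ := Ideal.mem_span_singleton.1 this
      exact ⟨c, by rw [hc]; simp⟩
    · rw [coeff_zero_eq_eval_zero, eval_comp, eval_add, eval_X, eval_one, zero_add,
        eval_one_cyclotomic_prime_pow, Ideal.span_singleton_pow, Ideal.mem_span_singleton, sq]
      rintro ⟨c, hc⟩
      refine hpp.not_isUnit (IsUnit.of_mul_eq_one c (mul_left_cancel₀ hpp.ne_zero ?_))
      rw [mul_one, ← mul_assoc, ← hc]
  have hirr := hei.irreducible ((Ideal.span_singleton_prime hpp.ne_zero).2 hpp)
    hmonic.isPrimitive (by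
      rw [hX, natDegree_comp, natDegree_X_add_C, mul_one, natDegree_cyclotomic]
      exact Nat.totient_pos.2 (pow_pos hp.out.pos _))
  have h2 : Irreducible (cyclotomic (p ^ (k + 1)) ℤ_[p]) := by
    rw [← MulEquiv.irreducible_iff (algEquivAevalXAddC (1 : ℤ_[p]))]
    simpa [algEquivAevalXAddC_apply, aeval_def, comp] using hirr
  rw [← map_cyclotomic _ (algebraMap ℤ_[p] ℚ_[p])]
  exact ((cyclotomic.monic _ _).irreducible_iff_irreducible_map_fraction_map).1 h2

namespace PadicStmt

theorem natCast_mem_maxIdeal (p : ℕ) [Fact p.Prime] (K : Type) [Field K] [Algebra ℚ_[p] K] :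
    (p : O p K) ∈ maxIdeal p K := by
  refine Ideal.mem_sInf.2 fun {J} hJ ↦ ?_
  have := hJ.2
  have hmax := Ideal.isMaximal_comap_of_isIntegral_of_isMaximal (R := ℤ_[p]) J
  have hp : (p : ℤ_[p]) ∈ J.comap (algebraMap ℤ_[p] (O p K)) := by
    rw [IsLocalRing.eq_maximalIdeal hmax, PadicInt.maximalIdeal_eq_span_p]
    exact Ideal.mem_span_singleton_self _
  simpa using hp

theorem one_sub_mem_maxIdeal {p : ℕ} [hp : Fact p.Prime] {K : Type} [Field K] [Algebra ℚ_[p] K]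
    {η : O p K} {n : ℕ} (hη : η ^ p ^ n = 1) : 1 - η ∈ maxIdeal p K := by
  obtain ⟨r, hr⟩ := exists_add_pow_prime_pow_eq hp.out (1 - η) η n
  rw [sub_add_cancel, one_pow, hη] at hr
  have h : (1 - η) ^ p ^ n ∈ maxIdeal p K := by
    rw [show (1 - η) ^ p ^ n = p * (-((1 - η) * η * r)) by linear_combination -hr]
    exact Ideal.mul_mem_right _ _ (natCast_mem_maxIdeal p K)
  exact Ideal.mem_sInf.2 fun {J} hJ ↦ hJ.2.isPrime.mem_of_pow_mem _ (Ideal.mem_sInf.1 h hJ)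

open Polynomial in
theorem natCast_mem_maxIdeal_pow {p : ℕ} [hp : Fact p.Prime] {K : Type} [Field K]
    [Algebra ℚ_[p] K] {k : ℕ} {z : O p K} (hz : IsPrimitiveRoot z (p ^ (k + 1))) :
    (p : O p K) ∈ maxIdeal p K ^ (p ^ k * (p - 1)) := by
  rw [← eval_one_cyclotomic_prime_pow (R := O p K) (p := p) k,
    cyclotomic_eq_prod_X_sub_primitiveRoots hz, eval_prod,
    ← Nat.totient_prime_pow_succ hp.out, ← hz.card_primitiveRoots, ← Finset.prod_const]
  refine Ideal.prod_mem_prod fun η hη ↦ ?_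
  have := ((mem_primitiveRoots (pow_pos hp.out.pos _)).1 hη).1
  simpa using one_sub_mem_maxIdeal this

open Polynomial in
theorem geom_sum_mem_maxIdeal_pow {p : ℕ} [hp : Fact p.Prime] {K : Type} [Field K]
    [Algebra ℚ_[p] K] {k : ℕ} {z : O p K} (hz : IsPrimitiveRoot z (p ^ (k + 1))) :
    ∑ i ∈ Finset.range (p ^ k), z ^ i ∈ maxIdeal p K ^ (p ^ k - 1) := by
  classical
  have hq : 0 < p ^ k := pow_pos hp.out.pos k
  have hξ : IsPrimitiveRoot (z ^ p) (p ^ k) := hz.pow (pow_pos hp.out.pos _) (pow_succ' p k)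
  have hz1 : 1 - z ≠ 0 :=
    sub_ne_zero.2 (hz.ne_one (Nat.one_lt_pow k.succ_ne_zero hp.out.one_lt)).symm
  have h1 : (1 : O p K) ∈ nthRootsFinset (p ^ k) (1 : O p K) := by
    rw [mem_nthRootsFinset hq, one_pow]
  have hprod := hξ.pow_sub_pow_eq_prod_sub_mul 1 z hq
  rw [← Finset.prod_erase_mul _ _ h1, one_pow, one_mul, ← mul_neg_geom_sum, mul_comm] at hprod
  rw [mul_right_cancel₀ hz1 hprod]
  have hcard : p ^ k - 1 = ((nthRootsFinset (p ^ k) (1 : O p K)).erase 1).card := by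
    rw [Finset.card_erase_of_mem h1, hξ.card_nthRootsFinset]
  rw [hcard, ← Finset.prod_const]
  refine Ideal.prod_mem_prod fun ξ hξ ↦ one_sub_mem_maxIdeal (n := k + 1) ?_
  rw [mul_pow, hz.1, mul_one, pow_succ, pow_mul,
    (mem_nthRootsFinset hq _).1 (Finset.mem_of_mem_erase hξ), one_pow]

open Polynomial in
theorem algebraMap_norm_eq_prod_primitiveRoots {F L : Type*} [Field F] [Field L] [Algebra F L]
    {n : ℕ} [NeZero n] [IsCyclotomicExtension {n} F L] {ζ : L}
    (hζ : IsPrimitiveRoot ζ n) (hirr : Irreducible (cyclotomic n F)) (f : ℤ[X]) :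
    algebraMap F L (Algebra.norm F (aeval ζ f)) = ∏ η ∈ primitiveRoots n L, aeval η f := by
  have := IsCyclotomicExtension.isGalois {n} F L
  have := IsCyclotomicExtension.finiteDimensional {n} F L
  rw [Algebra.norm_eq_prod_automorphisms,
    ← Finset.prod_coe_sort (primitiveRoots n L) fun η ↦ aeval η f]
  refine Fintype.prod_equiv ((algEquivEquivAlgHom F L).toEquiv.trans
    (hζ.embeddingsEquivPrimitiveRoots L hirr)) _ _ fun σ ↦ ?_
  simp only [Equiv.trans_apply, IsPrimitiveRoot.embeddingsEquivPrimitiveRoots_apply_coe]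
  exact (aeval_algHom_apply ((σ : L →ₐ[F] L).restrictScalars ℤ) ζ f).symm

open Polynomial in
theorem coe_prod_primitiveRoots {p : ℕ} [Fact p.Prime] {K : Type} [Field K] [Algebra ℚ_[p] K]
    {n : ℕ} (hn : 0 < n) (f : ℤ[X]) :
    ((∏ η ∈ primitiveRoots n (O p K), aeval η f : O p K) : K) =
      ∏ η ∈ primitiveRoots n K, aeval η f := by
  have hinj : Function.Injective (O p K).val := Subtype.val_injective
  refine (map_prod (O p K).val _ _).trans ?_
  refine Finset.prod_bij (fun η _ ↦ (O p K).val η) ?_ (fun _ _ _ _ h ↦ hinj h) ?_ ?_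
  · intro η hη
    rw [mem_primitiveRoots hn] at hη ⊢
    exact hη.map_of_injective hinj
  · intro η hη
    rw [mem_primitiveRoots hn] at hη
    refine ⟨⟨η, (hη.isIntegral hn).tower_top⟩, ?_, rfl⟩
    rw [mem_primitiveRoots hn]
    exact IsPrimitiveRoot.of_map_of_injective (f := (O p K).val) hη hinj
  · intro η _
    exact (aeval_algHom_apply ((O p K).val.restrictScalars ℤ) η f).symm

end PadicStmt

open PadicStmt in
/-- Let `K = ℚ_p(ζ_{p^m})`, `m ≥ 1`.  Then
`N_{K/ℚ_p}(U_{p^m - 1, K}) ⊄ U_{m+1, ℚ_p}`:  there is a unit `u` of `K` with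
`v_K(1-u) ≥ p^m - 1` and `N_{K/ℚ_p}(u) ≢ 1 (mod p^{m+1})`. -/
theorem stmt15 (p : ℕ) [Fact p.Prime] (m : ℕ) (hm : 1 ≤ m)
    (K : Type) [Field K] [Algebra ℚ_[p] K] [FiniteDimensional ℚ_[p] K]
    (ζ : K) (hζ : IsPrimitiveRoot ζ (p ^ m)) (hgen : Algebra.adjoin ℚ_[p] {ζ} = ⊤) :
    ∃ u : K, InU p K (p ^ m - 1) u ∧
      ¬ ‖Algebra.norm ℚ_[p] u - 1‖ ≤ (p : ℝ) ^ (-((m : ℤ) + 1)) := by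
  obtain ⟨k, rfl⟩ : ∃ k, m = k + 1 := ⟨m - 1, by omega⟩
  have hp : p.Prime := Fact.out
  have hn : 0 < p ^ (k + 1) := pow_pos hp.pos _
  have : NeZero (p ^ (k + 1)) := ⟨hn.ne'⟩
  have hcyc : IsCyclotomicExtension {p ^ (k + 1)} ℚ_[p] K := by
    refine (IsCyclotomicExtension.iff_singleton _ _ _).2 ⟨⟨ζ, hζ⟩, fun x ↦ ?_⟩
    have hx : x ∈ Algebra.adjoin ℚ_[p] {ζ} := hgen ▸ Algebra.mem_top
    exact Algebra.adjoin_mono (by simpa using hζ.pow_eq_one) hx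
  obtain ⟨z, rfl⟩ : ∃ z : O p K, (z : K) = ζ := ⟨⟨ζ, (hζ.isIntegral hn).tower_top⟩, rfl⟩
  have hz : IsPrimitiveRoot z (p ^ (k + 1)) :=
    IsPrimitiveRoot.of_map_of_injective (f := (O p K).val) hζ Subtype.val_injective
  set y : O p K := ∑ i ∈ Finset.range (p ^ k), z ^ i with hy
  have hpm := natCast_mem_maxIdeal p K
  have hunit : IsUnit (1 + p * y) := by
    rw [add_comm]
    exact Ideal.mem_jacobson_bot.1 hpm y
  refine ⟨((1 + p * y : O p K) : K), ⟨⟨hunit.unit, rfl⟩, ⟨-(p * y), ?_, ?_⟩⟩, fun hle ↦ ?_⟩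
  · push_cast
    ring
  · have hexp : p ^ (k + 1) - 1 = p ^ k * (p - 1) + (p ^ k - 1) := by
      have h1 : 0 < p ^ k := pow_pos hp.pos k
      obtain ⟨j, rfl⟩ : ∃ j, p = j + 1 := ⟨p - 1, by have := hp.pos; omega⟩
      rw [pow_succ, Nat.add_sub_cancel, mul_add, mul_one]
      omega
    rw [hexp, pow_add]
    exact neg_mem (Ideal.mul_mem_mul (natCast_mem_maxIdeal_pow hz) (geom_sum_mem_maxIdeal_pow hz))
  · obtain ⟨r, hr⟩ := hz.exists_prod_one_add_geom_sum hp
    have hnorm : algebraMap ℚ_[p] K (Algebra.norm ℚ_[p] ((1 + p * y : O p K) : K)) =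
        ((1 + (p : O p K) ^ (k + 1) * (p * r - 1) : O p K) : K) := by
      let f : Polynomial ℤ := 1 + (p : Polynomial ℤ) * ∑ i ∈ Finset.range (p ^ k), Polynomial.X ^ i
      have h1 := algebraMap_norm_eq_prod_primitiveRoots hζ
        (irreducible_cyclotomic_prime_pow_padic p k) f
      rw [← coe_prod_primitiveRoots (p := p) hn] at h1
      have hf {A : Type} [CommRing A] (a : A) : Polynomial.aeval a f =
        1 + (p : A) * ∑ i ∈ Finset.range (p ^ k), a ^ i := by simp [f]
      simp only [hf] at h1
      rw [hr] at h1
      rw [← h1, hy]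
      push_cast
      rfl
    have hpQ : (p : ℚ_[p]) ≠ 0 := Nat.cast_ne_zero.2 hp.ne_zero
    have hpK : (p : K) ≠ 0 := by
      rw [← map_natCast (algebraMap ℚ_[p] K)]
      exact (map_ne_zero _).2 hpQ
    obtain ⟨b, hb⟩ : ∃ b : ℤ_[p],
        Algebra.norm ℚ_[p] ((1 + p * y : O p K) : K) - 1 = (p : ℚ_[p]) ^ (k + 2) * b := by
      set a := Algebra.norm ℚ_[p] ((1 + p * y : O p K) : K) - 1
      refine ⟨⟨a / (p : ℚ_[p]) ^ (k + 2), ?_⟩, ?_⟩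
      · rw [norm_div, norm_pow, Padic.norm_p, inv_pow, div_inv_eq_mul]
        have hp0 : (0 : ℝ) < p := Nat.cast_pos.2 hp.pos
        calc ‖a‖ * (p : ℝ) ^ (k + 2)
            ≤ (p : ℝ) ^ (-(((k + 1 : ℕ) : ℤ) + 1)) * (p : ℝ) ^ (k + 2) := by gcongr
          _ = 1 := by
            rw [← zpow_natCast, ← zpow_add₀ hp0.ne']
            simp [add_assoc]
      · exact (mul_div_cancel₀ _ (pow_ne_zero _ hpQ)).symm
    obtain ⟨β, hβ⟩ : ∃ β : O p K, (β : K) = algebraMap ℚ_[p] K b :=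
      ⟨algebraMap ℤ_[p] (O p K) b, rfl⟩
    have hK : (p : K) ^ (k + 1) * (p * (r : K) - 1) =
        (p : K) ^ (k + 1) * (p * (β : K)) := by
      have h2 := congrArg (algebraMap ℚ_[p] K) hb
      rw [map_sub, hnorm] at h2
      simp only [map_mul, map_pow, map_natCast, map_one] at h2
      push_cast at h2
      rw [hβ]
      linear_combination h2
    have hO : (p : O p K) * (r - β) = 1 := by
      apply Subtype.ext
      have := mul_left_cancel₀ (pow_ne_zero _ hpK) hK
      push_cast
      linear_combination this
    have h0 : IsUnit ((p : O p K) * (-(r - β)) + 1) :=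
      Ideal.mem_jacobson_bot.1 hpm _
    rw [mul_neg, hO, neg_add_cancel] at h0
    exact not_isUnit_zero h0
end
end
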